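/- Suppose θ_NE(p) > 0 for every p > 1/2. Then the H-model has critical probability 1/2: θ_H(p) = 0 for every p < 1/2 and θ_H(p) > 0 for every p > 1/2. -/

import Mathlib

open MeasureTheory ENNReal

namespace RandomOrientation

/-- One step of the base-`(p, 1-p)` expansion map on `[0,1)`. -/
noncomputable def expand (p x : ℝ) : ℝ := if x < p then x / p else (x - p) / (1 - p)

/-- The `n`-th digit of the Bernoulli(`p`) expansion of `x`: for `x` uniformly
distributed on `[0,1)` the digits are i.i.d. `{true, false}`-valued with
`P(true) = p`. -/
noncomputable def bernDigit (p : ℝ) (n : ℕ) (x : ℝ) : Bool :=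
  decide ((expand p)^[n] x < p)

/-- The product over the countable index set `I` of Bernoulli(`p`) measures on
`Bool` (`P(true) = p`), realized as the joint distribution of the digits of the
Bernoulli(`p`) expansion of a uniform random point of `[0,1)`. -/
noncomputable def bernoulliProduct (I : Type*) [Encodable I] (p : ℝ) :
    Measure (I → Bool) :=
  Measure.map (fun x i => bernDigit p (Encodable.encode i) x)
    (volume.restrict (Set.Ico (0 : ℝ) 1))

/-- Edges of `ℤ²`: `(v, false)` is the horizontal edge from `v` to `v + (1,0)`,
`(v, true)` the vertical edge from `v` to `v + (0,1)`. -/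
abbrev Edge : Type := (ℤ × ℤ) × Bool

/-- An orientation configuration of the edges of `ℤ²`. -/
abbrev Config : Type := Edge → Bool

def eSrc (e : Edge) : ℤ × ℤ := e.1

def eDst (e : Edge) : ℤ × ℤ := if e.2 then (e.1.1, e.1.2 + 1) else (e.1.1 + 1, e.1.2)

/-- The law of the random orientation with parameter `p`: each edge independently
carries the bit `true` with probability `p`. -/
noncomputable def mu (p : ℝ) : Measure Config := bernoulliProduct Edge p

/-- The directed-edge relation of Grimmett's random-orientation model:
`ω e = true` means the edge `e` is oriented in the positive coordinate direction
(rightwards resp. upwards), `ω e = false` in the negative one. -/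
def gStep (ω : Config) (u v : ℤ × ℤ) : Prop :=
  ∃ e : Edge, (eSrc e = u ∧ eDst e = v ∧ ω e = true) ∨ (eSrc e = v ∧ eDst e = u ∧ ω e = false)

/-- Squared euclidean norm on `ℤ²`. -/
def normSq (v : ℤ × ℤ) : ℤ := v.1 ^ 2 + v.2 ^ 2

/-- The directed-edge relation of the H-model: `ω e = true` means the edge `e` is
oriented away from the origin, i.e. towards its endpoint of larger euclidean norm
(adjacent vertices of `ℤ²` never have equal norms). -/
def hStep (ω : Config) (u v : ℤ × ℤ) : Prop :=
  ∃ e : Edge, ((eSrc e = u ∧ eDst e = v) ∨ (eSrc e = v ∧ eDst e = u)) ∧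
    ω e = decide (normSq u < normSq v)

/-- There is an infinite directed self-avoiding path starting at the origin,
all of whose vertices lie in `S`, for the directed-step relation `R`. -/
def percolates (R : ℤ × ℤ → ℤ × ℤ → Prop) (S : Set (ℤ × ℤ)) : Prop :=
  ∃ γ : ℕ → ℤ × ℤ, γ 0 = (0, 0) ∧ Function.Injective γ ∧
    (∀ n, R (γ n) (γ (n + 1))) ∧ ∀ n, γ n ∈ S

/-- The (closed) North-East quadrant of `ℤ²`. -/
def NEquad : Set (ℤ × ℤ) := {v | 0 ≤ v.1 ∧ 0 ≤ v.2}

/-- `θ_H(p)`: percolation probability of the H-model with parameter `p`. -/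
noncomputable def thetaH (p : ℝ) : ℝ≥0∞ := mu p {ω | percolates (hStep ω) Set.univ}

/-- `θ_NE(p)`: probability of an infinite directed self-avoiding path from the
origin staying in the North-East quadrant, in the random-orientation model. -/
noncomputable def thetaNE (p : ℝ) : ℝ≥0∞ := mu p {ω | percolates (gStep ω) NEquad}

/-- `θ_G(p)`: percolation probability of Grimmett's random-orientation model. -/
noncomputable def thetaG (p : ℝ) : ℝ≥0∞ := mu p {ω | percolates (gStep ω) Set.univ}

/-! ### The Bernoulli product measure -/

/-- The Bernoulli measure on `Bool` with `P(true) = p`. -/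
noncomputable def bern (p : unitInterval) : Measure Bool :=
  ENNReal.ofReal p • Measure.dirac true + ENNReal.ofReal (1 - p) • Measure.dirac false

instance (p : unitInterval) : IsProbabilityMeasure (bern p) := by
  constructor
  have h0 := p.2.1
  have h1 := p.2.2
  simp [bern]
  rw [← ENNReal.ofReal_add h0 (by linarith)]
  simp

lemma bern_true (p : unitInterval) : bern p {true} = ENNReal.ofReal p := by
  simp [bern]

lemma bern_false (p : unitInterval) : bern p {false} = ENNReal.ofReal (1 - p) := by
  simp [bern]

open Classical in
lemma bern_apply (p : unitInterval) (t : Set Bool) :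
    bern p t = (if true ∈ t then ENNReal.ofReal p else 0)
      + (if false ∈ t then ENNReal.ofReal (1 - p) else 0) := by
  simp [bern, Set.indicator]

lemma bern_map_not (p : unitInterval) :
    (bern p).map (fun b => !b) = bern (unitInterval.symm p) := by
  rw [bern, Measure.map_add _ _ (by fun_prop), Measure.map_smul, Measure.map_smul,
    Measure.map_dirac' (by fun_prop), Measure.map_dirac' (by fun_prop), bern, add_comm]
  simp

/-- The law of independent Bernoulli(`p`) bits indexed by `I`. -/
noncomputable def bits (I : Type*) (p : unitInterval) : Measure (I → Bool) :=
  Measure.infinitePi fun _ => bern p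

instance (I : Type*) (p : unitInterval) : IsProbabilityMeasure (bits I p) := by
  unfold bits; infer_instance

lemma measurable_expand (p : ℝ) : Measurable (expand p) := by
  unfold expand
  exact Measurable.ite measurableSet_Iio (by fun_prop) (by fun_prop)

lemma measurable_bernDigit (p : ℝ) (n : ℕ) : Measurable (bernDigit p n) := by
  refine measurable_to_bool ?_
  have : bernDigit p n ⁻¹' {true} = {x | (expand p)^[n] x < p} := by
    ext x; simp [bernDigit]
  rw [this]
  exact measurableSet_lt ((measurable_expand p).iterate n) measurable_const

lemma volume_expand_lower (p : unitInterval) (A : Set ℝ) :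
    volume (Set.Ico (0 : ℝ) 1 ∩ {x | x < p ∧ expand p x ∈ A})
      = ENNReal.ofReal p * volume (Set.Ico (0 : ℝ) 1 ∩ A) := by
  have h0 := p.2.1
  have h1 := p.2.2
  rcases h0.eq_or_lt with h | h
  · rw [← h]
    have : Set.Ico (0 : ℝ) 1 ∩ {x | x < 0 ∧ expand 0 x ∈ A} = ∅ := by
      ext x; simp; intro a b c; linarith
    simp [this]
  · have : Set.Ico (0 : ℝ) 1 ∩ {x | x < p ∧ expand p x ∈ A}
        = ((p : ℝ)⁻¹ * ·) ⁻¹' (Set.Ico (0 : ℝ) 1 ∩ A) := by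
      ext x
      simp only [Set.mem_inter_iff, Set.mem_Ico, Set.mem_ofPred_eq, Set.mem_preimage]
      rw [inv_mul_eq_div, div_nonneg_iff, div_lt_one h]
      constructor
      · rintro ⟨⟨a, b⟩, c, d⟩
        refine ⟨⟨Or.inl ⟨a, h0⟩, c⟩, ?_⟩
        rwa [expand, if_pos c] at d
      · rintro ⟨⟨a, c⟩, d⟩
        have a' : 0 ≤ x := by rcases a with a | a <;> linarith
        refine ⟨⟨a', by linarith⟩, c, ?_⟩
        rwa [expand, if_pos c]
    rw [this, Real.volume_preimage_mul_left (by positivity), inv_inv, abs_of_pos h]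

lemma volume_expand_upper (p : unitInterval) (A : Set ℝ) :
    volume (Set.Ico (0 : ℝ) 1 ∩ {x | ¬ x < p ∧ expand p x ∈ A})
      = ENNReal.ofReal (1 - p) * volume (Set.Ico (0 : ℝ) 1 ∩ A) := by
  have h0 := p.2.1
  have h1 := p.2.2
  rcases h1.eq_or_lt with h | h
  · rw [h]
    have : Set.Ico (0 : ℝ) 1 ∩ {x | ¬ x < 1 ∧ expand 1 x ∈ A} = ∅ := by
      ext x; simp; intro a b c; linarith
    rw [this]
    simp
  · have hp : 0 < 1 - (p : ℝ) := by linarith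
    have : Set.Ico (0 : ℝ) 1 ∩ {x | ¬ x < p ∧ expand p x ∈ A}
        = (· + (-p : ℝ)) ⁻¹' (((1 - p : ℝ)⁻¹ * ·) ⁻¹' (Set.Ico (0 : ℝ) 1 ∩ A)) := by
      ext x
      simp only [Set.mem_inter_iff, Set.mem_Ico, Set.mem_ofPred_eq, Set.mem_preimage]
      rw [inv_mul_eq_div, div_nonneg_iff, div_lt_one hp, ← sub_eq_add_neg]
      constructor
      · rintro ⟨⟨a, b⟩, c, d⟩
        refine ⟨⟨Or.inl ⟨by linarith, hp.le⟩, by linarith⟩, ?_⟩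
        rwa [expand, if_neg c] at d
      · rintro ⟨⟨a, c⟩, d⟩
        have a' : (p : ℝ) ≤ x := by rcases a with a | a <;> linarith
        refine ⟨⟨by linarith, by linarith⟩, by linarith, ?_⟩
        rwa [expand, if_neg (by linarith)]
    rw [this, measure_preimage_add_right, Real.volume_preimage_mul_left (by positivity), inv_inv,
      abs_of_pos hp]

lemma volume_bernDigit_box (p : unitInterval) (n : ℕ) (t : ℕ → Set Bool) :
    volume (Set.Ico (0 : ℝ) 1 ∩ {x | ∀ i < n, bernDigit p i x ∈ t i})
      = ∏ i ∈ Finset.range n, bern p (t i) := by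
  induction n generalizing t with
  | zero => simp
  | succ n ih =>
    set A : Set ℝ := {x | ∀ i < n, bernDigit p i x ∈ t (i + 1)} with hA
    have hmem : ∀ x, (∀ i < n + 1, bernDigit p i x ∈ t i) ↔
        (decide (x < p) ∈ t 0 ∧ expand p x ∈ A) := by
      intro x
      constructor
      · intro h
        exact ⟨h 0 (by omega), fun i hi => h (i + 1) (by omega)⟩
      · rintro ⟨h, h'⟩ i hi
        cases i with
        | zero => exact h
        | succ i => exact h' i (by omega)
    rw [Finset.prod_range_succ', ← ih (fun i => t (i + 1)), ← hA,
      ← measure_inter_add_sdiff (Set.Ico (0 : ℝ) 1 ∩ _) (measurableSet_Iio (a := (p : ℝ))),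
      bern_apply, mul_add, mul_comm, mul_comm (volume (Set.Ico (0 : ℝ) 1 ∩ A))]
    congr 1
    · split_ifs with h
      · rw [← volume_expand_lower]
        congr 1
        ext x
        simp only [Set.mem_inter_iff, Set.mem_ofPred_eq, hmem, Set.mem_Iio]
        constructor
        · rintro ⟨⟨a, b, c⟩, d⟩; exact ⟨a, d, c⟩
        · rintro ⟨a, d, c⟩; exact ⟨⟨a, by simpa [d] using h, c⟩, d⟩
      · rw [zero_mul]
        convert measure_empty (μ := (volume : Measure ℝ))
        ext x
        simp only [Set.mem_inter_iff, Set.mem_ofPred_eq, hmem, Set.mem_Iio, Set.mem_empty_iff_false,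
          iff_false]
        rintro ⟨⟨a, b, c⟩, d⟩
        simp [d] at b
        exact h b
    · split_ifs with h
      · rw [← volume_expand_upper]
        congr 1
        ext x
        simp only [Set.mem_inter_iff, Set.mem_ofPred_eq, hmem, Set.mem_sdiff, Set.mem_Iio]
        constructor
        · rintro ⟨⟨a, b, c⟩, d⟩; exact ⟨a, d, c⟩
        · rintro ⟨a, d, c⟩; exact ⟨⟨a, by simpa [d] using h, c⟩, d⟩
      · rw [zero_mul]
        convert measure_empty (μ := (volume : Measure ℝ))
        ext x
        simp only [Set.mem_inter_iff, Set.mem_ofPred_eq, hmem, Set.mem_sdiff, Set.mem_Iio,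
          Set.mem_empty_iff_false, iff_false]
        rintro ⟨⟨a, b, c⟩, d⟩
        simp [d] at b
        exact h b

lemma map_bernDigit (p : unitInterval) :
    Measure.map (fun x n => bernDigit p n x) (volume.restrict (Set.Ico (0 : ℝ) 1)) = bits ℕ p := by
  have hm : Measurable (fun x n => bernDigit p n x) :=
    measurable_pi_iff.2 fun n => measurable_bernDigit p n
  classical
  refine Measure.eq_infinitePi _ fun s t ht => ?_
  obtain ⟨n, hn⟩ : ∃ n, ∀ i ∈ s, i < n := by
    obtain ⟨n, hn⟩ := s.exists_nat_subset_range
    exact ⟨n, fun i hi => Finset.mem_range.1 (hn hi)⟩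
  have hpi : MeasurableSet (Set.pi (s : Set ℕ) t) := .pi s.countable_toSet fun i _ => ht i
  rw [Measure.map_apply hm hpi, Measure.restrict_apply (hm hpi), Set.inter_comm]
  have := volume_bernDigit_box p n (fun i => if i ∈ s then t i else Set.univ)
  convert this using 1
  · congr 2
    ext x
    simp only [Set.mem_preimage, Set.mem_pi, Finset.mem_coe, Set.mem_ofPred_eq]
    constructor
    · intro h i _
      split_ifs with his
      · exact h i his
      · trivial
    · intro h i hi
      simpa [hi] using h i (hn i hi)
  · rw [← Finset.prod_subset (s₁ := s) (fun i hi => Finset.mem_range.2 (hn i hi))]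
    · exact Finset.prod_congr rfl fun i hi => by simp [hi]
    · intro i _ hi; rw [if_neg hi, measure_univ]

/-- Reindexing independent bits along an injection preserves their law. -/
lemma measurePreserving_comp {I J : Type*} (p : unitInterval) {f : I → J}
    (hf : Function.Injective f) :
    MeasurePreserving (fun (ω : J → Bool) i => ω (f i)) (bits J p) (bits I p) :=
  ⟨by fun_prop, Measure.map_infinitePi_infinitePi_of_inj hf⟩

/-- Flipping all bits exchanges the parameters `p` and `1 - p`. -/
lemma measurePreserving_not (I : Type*) (p : unitInterval) :
    MeasurePreserving (fun (ω : I → Bool) i => !(ω i)) (bits I p)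
      (bits I (unitInterval.symm p)) := by
  refine ⟨by fun_prop, ?_⟩
  have := Measure.infinitePi_map_pi (μ := fun _ : I => bern p) (f := fun _ b => !b)
    (fun _ => by fun_prop)
  unfold bits
  simp only [bern_map_not] at this
  exact this

lemma mu_eq_bits (p : unitInterval) : mu p = bits Edge p := by
  unfold mu bernoulliProduct
  rw [← (measurePreserving_comp p (Encodable.encode_injective (α := Edge))).map_eq,
    ← map_bernDigit, Measure.map_map (by fun_prop)
      (measurable_pi_iff.2 fun n => measurable_bernDigit p n)]
  rfl

lemma bits_coord (I : Type*) (p : unitInterval) (i : I) (t : Set Bool) :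
    bits I p {ω | ω i ∈ t} = bern p t := by
  have := (measurePreserving_eval_infinitePi (fun _ : I => bern p) i).measure_preimage
    (s := t) (MeasurableSet.of_discrete).nullMeasurableSet
  exact this

/-! ### Independence and positive association -/

/-- Membership in `A` is determined by the coordinates in `K`. -/
def DependsOnCoords {I : Type*} (A : Set (I → Bool)) (K : Set I) : Prop :=
  ∀ ω ω' : I → Bool, (∀ i ∈ K, ω i = ω' i) → (ω ∈ A ↔ ω' ∈ A)

lemma DependsOnCoords.measurableSet_iSup {I : Type*} {A : Set (I → Bool)} {K : Set I}
    (hA : MeasurableSet A) (h : DependsOnCoords A K) :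
    MeasurableSet[⨆ i ∈ K, MeasurableSpace.comap (fun ω : I → Bool => ω i) inferInstance] A := by
  classical
  let ρ : (I → Bool) → (I → Bool) := fun ω i => if i ∈ K then ω i else false
  have hρ : @Measurable _ _ (⨆ i ∈ K, MeasurableSpace.comap (fun ω : I → Bool => ω i) inferInstance)
      MeasurableSpace.pi ρ := by
    refine @measurable_pi_lambda _ _ _
      (⨆ i ∈ K, MeasurableSpace.comap (fun ω : I → Bool => ω i) inferInstance) _ _ fun i => ?_
    by_cases hi : i ∈ K
    · simp only [ρ, hi, if_true]
      exact Measurable.of_comap_le (le_iSup₂_of_le i hi le_rfl)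
    · simp only [ρ, hi, if_false]
      exact measurable_const
  have : A = ρ ⁻¹' A := by
    ext ω
    exact h _ _ fun i hi => by simp [ρ, hi]
  rw [this]
  exact hρ hA

lemma DependsOnCoords.measure_inter {I : Type*} (p : unitInterval) {A B : Set (I → Bool)}
    {K L : Set I} (hA : MeasurableSet A) (hB : MeasurableSet B) (hAK : DependsOnCoords A K)
    (hBL : DependsOnCoords B L) (hKL : Disjoint K L) :
    bits I p (A ∩ B) = bits I p A * bits I p B := by
  have hi : ProbabilityTheory.iIndepFun (fun i (ω : I → Bool) => ω i) (bits I p) :=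
    ProbabilityTheory.iIndepFun_infinitePi (X := fun _ b => b) (fun _ => measurable_id)
  have := ProbabilityTheory.indep_iSup_of_disjoint (fun i => (measurable_pi_apply i).comap_le)
    hi.iIndep hKL
  exact (ProbabilityTheory.Indep_iff _ _ _).1 this A B (hAK.measurableSet_iSup hA)
    (hBL.measurableSet_iSup hB)

lemma measurable_update_const {I : Type*} [DecidableEq I] (d : I) (b : Bool) :
    Measurable fun ω : I → Bool => Function.update ω d b :=
  measurable_update_left

lemma bits_real_split {I : Type*} [DecidableEq I] (p : unitInterval) {A : Set (I → Bool)}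
    (hA : MeasurableSet A) (d : I) :
    (bits I p).real A = p * (bits I p).real {ω | Function.update ω d true ∈ A}
      + (1 - p) * (bits I p).real {ω | Function.update ω d false ∈ A} := by
  have key : ∀ b : Bool, (bits I p).real (A ∩ {ω | ω d ∈ ({b} : Set Bool)})
      = (bits I p).real {ω | Function.update ω d b ∈ A} * (bern p).real {b} := by
    intro b
    have hset : A ∩ {ω | ω d ∈ ({b} : Set Bool)}
        = {ω | Function.update ω d b ∈ A} ∩ {ω | ω d ∈ ({b} : Set Bool)} := by
      ext ω
      simp only [Set.mem_inter_iff, Set.mem_ofPred_eq, Set.mem_singleton_iff]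
      constructor
      · rintro ⟨h, rfl⟩; exact ⟨by rwa [Function.update_eq_self], rfl⟩
      · rintro ⟨h, rfl⟩; exact ⟨by rwa [Function.update_eq_self] at h, rfl⟩
    rw [hset, measureReal_def, DependsOnCoords.measure_inter p
      (A := {ω | Function.update ω d b ∈ A}) (B := {ω | ω d ∈ ({b} : Set Bool)})
      (K := {d}ᶜ) (L := {d}) (measurable_update_const d b hA)
      (measurable_pi_apply d (MeasurableSet.of_discrete)) ?_ ?_ disjoint_compl_left, bits_coord]
    · simp [measureReal_def]
    · intro ω ω' h
      have : Function.update ω d b = Function.update ω' d b := by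
        ext i
        by_cases hi : i = d
        · subst hi; simp
        · simp [hi, h i hi]
      simp only [Set.mem_ofPred_eq, this]
    · intro ω ω' h
      simp [h d rfl]
  have hsplit := measureReal_inter_add_sdiff (μ := bits I p)
    (s := A) (t := {ω | ω d ∈ ({true} : Set Bool)})
    (measurable_pi_apply d (MeasurableSet.of_discrete))
  have hdiff : A \ {ω | ω d ∈ ({true} : Set Bool)} = A ∩ {ω | ω d ∈ ({false} : Set Bool)} := by
    ext ω; simp
  rw [hdiff, key, key] at hsplit
  have h0 := p.2.1
  have h1 := p.2.2
  rw [← hsplit, measureReal_def (bern p), measureReal_def (bern p), bern_true, bern_false,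
    ENNReal.toReal_ofReal h0, ENNReal.toReal_ofReal (by linarith)]
  ring

/-- `A` is preserved when more coordinates are made to agree with `τ`. -/
def MonoTowards {I : Type*} (τ : I → Bool) (A : Set (I → Bool)) : Prop :=
  ∀ ω ω' : I → Bool, (∀ i, ω i = τ i → ω' i = τ i) → ω ∈ A → ω' ∈ A

lemma chebyshev_two_point {p a₁ a₀ b₁ b₀ : ℝ} (h0 : 0 ≤ p) (h1 : p ≤ 1)
    (h : 0 ≤ (a₁ - a₀) * (b₁ - b₀)) :
    (p * a₁ + (1 - p) * a₀) * (p * b₁ + (1 - p) * b₀) ≤ p * (a₁ * b₁) + (1 - p) * (a₀ * b₀) := by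
  nlinarith [mul_nonneg (mul_nonneg h0 (sub_nonneg.2 h1)) h]

lemma MonoTowards.update {I : Type*} [DecidableEq I] {τ : I → Bool} {A : Set (I → Bool)}
    (hA : MonoTowards τ A) (d : I) (b : Bool) :
    MonoTowards τ {ω | Function.update ω d b ∈ A} := by
  intro ω ω' h
  refine hA _ _ fun i => ?_
  by_cases hi : i = d
  · subst hi; simp
  · simpa [hi] using h i

lemma MonoTowards.update_subset {I : Type*} [DecidableEq I] {τ : I → Bool} {A : Set (I → Bool)}
    (hA : MonoTowards τ A) (d : I) (b : Bool) :
    {ω | Function.update ω d b ∈ A} ⊆ {ω | Function.update ω d (τ d) ∈ A} := by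
  intro ω
  refine hA _ _ fun i => ?_
  by_cases hi : i = d
  · subst hi; simp
  · simp [hi]

lemma DependsOnCoords.update {I : Type*} [DecidableEq I] {A : Set (I → Bool)} {d : I}
    {K : Finset I} (hA : DependsOnCoords A (insert d K : Finset I)) (b : Bool) :
    DependsOnCoords {ω | Function.update ω d b ∈ A} (K : Set I) := by
  intro ω ω' h
  refine hA _ _ fun i hi => ?_
  by_cases hid : i = d
  · subst hid; simp
  · have : i ∈ K := by simpa [hid] using hi
    simp [hid, h i this]

/-- Harris' inequality for events depending on finitely many coordinates. -/
lemma harris_finite {I : Type*} [DecidableEq I] (p : unitInterval) (τ : I → Bool) (K : Finset I)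
    {A B : Set (I → Bool)} (hA : MeasurableSet A) (hB : MeasurableSet B)
    (hAK : DependsOnCoords A K) (hBK : DependsOnCoords B K)
    (mA : MonoTowards τ A) (mB : MonoTowards τ B) :
    (bits I p).real A * (bits I p).real B ≤ (bits I p).real (A ∩ B) := by
  induction K using Finset.induction_on generalizing A B with
  | empty =>
    rcases A.eq_empty_or_nonempty with rfl | ⟨ω, hω⟩
    · simp
    · have : A = Set.univ := by
        ext ω'; simpa using (hAK ω ω' (by simp)).1 hω
      simp [this]
  | insert d K _ ih =>
    rw [bits_real_split p hA d, bits_real_split p hB d, bits_real_split p (hA.inter hB) d]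
    have hstep : ∀ b, (bits I p).real {ω | Function.update ω d b ∈ A} *
        (bits I p).real {ω | Function.update ω d b ∈ B} ≤
        (bits I p).real {ω | Function.update ω d b ∈ A ∩ B} := fun b =>
      ih (measurable_update_const d b hA) (measurable_update_const d b hB)
        (hAK.update b) (hBK.update b) (mA.update d b) (mB.update d b)
    have h0 := p.2.1
    have h1 := p.2.2
    refine (chebyshev_two_point h0 h1 ?_).trans
      (add_le_add (mul_le_mul_of_nonneg_left (hstep true) h0)
        (mul_le_mul_of_nonneg_left (hstep false) (by linarith)))
    have ha := fun b => measureReal_mono (μ := bits I p) (mA.update_subset d b)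
    have hb := fun b => measureReal_mono (μ := bits I p) (mB.update_subset d b)
    cases hτ : τ d
    · rw [hτ] at ha hb
      exact mul_nonneg_of_nonpos_of_nonpos (sub_nonpos.2 (ha true)) (sub_nonpos.2 (hb true))
    · rw [hτ] at ha hb
      exact mul_nonneg (sub_nonneg.2 (ha false)) (sub_nonneg.2 (hb false))

/-- Unions of cylinder events, each requiring finitely many coordinates to agree with `τ`. -/
def Inc {I : Type*} (τ : I → Bool) (A : Set (I → Bool)) : Prop :=
  ∃ 𝓕 : Set (Finset I), A = {ω | ∃ F ∈ 𝓕, ∀ i ∈ F, ω i = τ i}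

lemma Inc.inter {I : Type*} {τ : I → Bool} {A B : Set (I → Bool)} (hA : Inc τ A) (hB : Inc τ B) :
    Inc τ (A ∩ B) := by
  classical
  obtain ⟨𝓕, rfl⟩ := hA
  obtain ⟨𝓖, rfl⟩ := hB
  refine ⟨{H | ∃ F ∈ 𝓕, ∃ G ∈ 𝓖, H = F ∪ G}, ?_⟩
  ext ω
  constructor
  · rintro ⟨⟨F, hF, h⟩, G, hG, h'⟩
    refine ⟨F ∪ G, ⟨F, hF, G, hG, rfl⟩, fun i hi => ?_⟩
    rcases Finset.mem_union.1 hi with hi | hi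
    exacts [h i hi, h' i hi]
  · rintro ⟨_, ⟨F, hF, G, hG, rfl⟩, h⟩
    exact ⟨⟨F, hF, fun i hi => h i (Finset.mem_union_left _ hi)⟩,
      ⟨G, hG, fun i hi => h i (Finset.mem_union_right _ hi)⟩⟩

lemma Inc.comp {I : Type*} {τ : I → Bool} {A : Set (I → Bool)} (hA : Inc τ A) {ρ : I → I}
    (hρ : ∀ i, τ (ρ i) = τ i) : Inc τ {ω | (fun i => ω (ρ i)) ∈ A} := by
  classical
  obtain ⟨𝓕, rfl⟩ := hA
  refine ⟨{H | ∃ F ∈ 𝓕, H = F.image ρ}, ?_⟩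
  ext ω
  simp only [Set.mem_ofPred_eq]
  constructor
  · rintro ⟨F, hF, h⟩
    refine ⟨_, ⟨F, hF, rfl⟩, fun i hi => ?_⟩
    obtain ⟨j, hj, rfl⟩ := Finset.mem_image.1 hi
    rw [hρ]; exact h j hj
  · rintro ⟨_, ⟨F, hF, rfl⟩, h⟩
    exact ⟨F, hF, fun i hi => (h _ (Finset.mem_image_of_mem _ hi)).trans (hρ i)⟩

lemma measurableSet_cylinder_eq {I : Type*} (τ : I → Bool) (F : Finset I) :
    MeasurableSet {ω : I → Bool | ∀ i ∈ F, ω i = τ i} := by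
  have : {ω : I → Bool | ∀ i ∈ F, ω i = τ i} = ⋂ i ∈ F, {ω | ω i ∈ ({τ i} : Set Bool)} := by
    ext ω; simp
  rw [this]
  exact Finset.measurableSet_biInter F fun i _ =>
    measurable_pi_apply i (MeasurableSet.of_discrete (s := {τ i}))

lemma Inc.measurableSet {I : Type*} [Countable I] {τ : I → Bool} {A : Set (I → Bool)}
    (hA : Inc τ A) : MeasurableSet A := by
  obtain ⟨𝓕, rfl⟩ := hA
  have : {ω : I → Bool | ∃ F ∈ 𝓕, ∀ i ∈ F, ω i = τ i}
      = ⋃ F ∈ 𝓕, {ω : I → Bool | ∀ i ∈ F, ω i = τ i} := by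
    ext ω; simp
  rw [this]
  exact MeasurableSet.biUnion (Set.to_countable _) fun F _ => measurableSet_cylinder_eq τ F

lemma Inc.exists_approx {I : Type*} [Countable I] {τ : I → Bool} {A : Set (I → Bool)}
    (hA : Inc τ A) : ∃ a : ℕ → Set (I → Bool), Monotone a ∧ ⋃ n, a n = A ∧
      ∀ n, MeasurableSet (a n) ∧ MonoTowards τ (a n) ∧
        ∃ K : Finset I, DependsOnCoords (a n) K := by
  classical
  obtain ⟨𝓕, rfl⟩ := hA
  let enc : Encodable (Finset I) := Encodable.ofCountable _
  refine ⟨fun n => {ω | ∃ F ∈ {F ∈ 𝓕 | Encodable.encode F ≤ n}, ∀ i ∈ F, ω i = τ i}, ?_, ?_, ?_⟩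
  · rintro m n hmn ω ⟨F, ⟨hF, hm⟩, h⟩
    exact ⟨F, ⟨hF, hm.trans hmn⟩, h⟩
  · ext ω
    simp only [Set.mem_iUnion, Set.mem_ofPred_eq]
    constructor
    · rintro ⟨n, F, ⟨hF, _⟩, h⟩; exact ⟨F, hF, h⟩
    · rintro ⟨F, hF, h⟩; exact ⟨_, F, ⟨hF, le_rfl⟩, h⟩
  · intro n
    refine ⟨Inc.measurableSet ⟨_, rfl⟩, ?_, ?_⟩
    · rintro ω ω' h ⟨F, hF, hF'⟩
      exact ⟨F, hF, fun i hi => h i (hF' i hi)⟩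
    · have hfin : {F ∈ 𝓕 | Encodable.encode F ≤ n}.Finite := by
        refine Set.Finite.of_finite_image (f := Encodable.encode) ?_
          Encodable.encode_injective.injOn
        exact (Set.finite_Iic n).subset (by rintro _ ⟨F, hF, rfl⟩; exact hF.2)
      refine ⟨hfin.toFinset.biUnion id, fun ω ω' h => ?_⟩
      have : ∀ F ∈ {F ∈ 𝓕 | Encodable.encode F ≤ n}, ∀ i ∈ F, ω i = ω' i := fun F hF i hi =>
        h i (by
          simp only [Finset.coe_biUnion, Set.mem_iUnion]
          exact ⟨F, by simpa using hF, hi⟩)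
      constructor
      · rintro ⟨F, hF, h'⟩; exact ⟨F, hF, fun i hi => (this F hF i hi) ▸ h' i hi⟩
      · rintro ⟨F, hF, h'⟩; exact ⟨F, hF, fun i hi => (this F hF i hi).symm ▸ h' i hi⟩

lemma tendsto_measureReal_iUnion {Ω : Type*} [MeasurableSpace Ω] (P : Measure Ω)
    [IsFiniteMeasure P] {a : ℕ → Set Ω} (ha : Monotone a) :
    Filter.Tendsto (fun n => P.real (a n)) Filter.atTop (nhds (P.real (⋃ n, a n))) :=
  (ENNReal.tendsto_toReal (measure_ne_top _ _)).comp (tendsto_measure_iUnion_atTop ha)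

/-- Harris' inequality. -/
lemma Inc.harris {I : Type*} [Countable I] (p : unitInterval) {τ : I → Bool}
    {A B : Set (I → Bool)} (hA : Inc τ A) (hB : Inc τ B) :
    (bits I p).real A * (bits I p).real B ≤ (bits I p).real (A ∩ B) := by
  classical
  obtain ⟨a, ma, rfl, ha⟩ := hA.exists_approx
  obtain ⟨b, mb, rfl, hb⟩ := hB.exists_approx
  refine le_of_tendsto' ((tendsto_measureReal_iUnion _ ma).mul (tendsto_measureReal_iUnion _ mb))
    fun n => ?_
  obtain ⟨h1, h2, K, hK⟩ := ha n
  obtain ⟨h1', h2', L, hL⟩ := hb n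
  refine (harris_finite p τ (K ∪ L) h1 h1' ?_ ?_ h2 h2').trans
    (measureReal_mono (Set.inter_subset_inter (Set.subset_iUnion _ n) (Set.subset_iUnion _ n)))
  · exact fun ω ω' h => hK _ _ fun i hi => h i (by simp at hi ⊢; exact Or.inl hi)
  · exact fun ω ω' h => hL _ _ fun i hi => h i (by simp at hi ⊢; exact Or.inr hi)

/-! ### Directed edges and reachability -/

/-- Directed edges of `ℤ²`: `(e, true)` is `e` traversed in the positive direction, `(e, false)`
is `e` traversed in the negative direction. -/
abbrev DEdge : Type := Edge × Bool

def src (d : DEdge) : ℤ × ℤ := if d.2 then eSrc d.1 else eDst d.1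

def dst (d : DEdge) : ℤ × ℤ := if d.2 then eDst d.1 else eSrc d.1

/-- A vertex of `B` can be reached from `a` along the directed edges in `F`. -/
def Reach (F : Set DEdge) (a : ℤ × ℤ) (B : Set (ℤ × ℤ)) : Prop :=
  ∃ b ∈ B, Relation.ReflTransGen (fun u v => ∃ d ∈ F, src d = u ∧ dst d = v) a b

lemma Reach.mono {F G : Set DEdge} {a : ℤ × ℤ} {B : Set (ℤ × ℤ)} (h : F ⊆ G)
    (hF : Reach F a B) : Reach G a B := by
  obtain ⟨b, hb, hr⟩ := hF
  exact ⟨b, hb, Relation.ReflTransGen.mono (fun u v ⟨d, hd, h'⟩ => ⟨d, h hd, h'⟩) _ _ hr⟩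

lemma Reach.exists_finset {F : Set DEdge} {a : ℤ × ℤ} {B : Set (ℤ × ℤ)} (hF : Reach F a B) :
    ∃ G : Finset DEdge, (G : Set DEdge) ⊆ F ∧ Reach G a B := by
  classical
  obtain ⟨b, hb, hr⟩ := hF
  suffices ∃ G : Finset DEdge, (G : Set DEdge) ⊆ F ∧ Reach G a {b} by
    obtain ⟨G, hG, c, rfl, hr'⟩ := this
    exact ⟨G, hG, _, hb, hr'⟩
  clear hb
  induction hr with
  | refl => exact ⟨∅, by simp, a, rfl, .refl⟩
  | tail _ h ih =>
    obtain ⟨G, hG, c, rfl, hr⟩ := ih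
    obtain ⟨d, hd, h1, h2⟩ := h
    refine ⟨insert d G, ?_, _, rfl, ?_⟩
    · simpa [Set.insert_subset_iff] using ⟨hd, hG⟩
    · refine Relation.ReflTransGen.tail (Relation.ReflTransGen.mono ?_ _ _ hr) ⟨d, by simp, h1, h2⟩
      rintro u v ⟨d', hd', h'⟩
      exact ⟨d', by simp [Finset.mem_coe.1 hd'], h'⟩

lemma reach_iff_of_dst {F G : Set DEdge} {a : ℤ × ℤ} {B : Set (ℤ × ℤ)} (h : F ⊆ G)
    (hd : ∀ d ∈ G, d ∉ F → Reach F a {dst d} ∨ ¬ Reach F a {src d}) :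
    Reach G a B ↔ Reach F a B := by
  refine ⟨?_, Reach.mono h⟩
  rintro ⟨b, hb, hr⟩
  refine ⟨b, hb, ?_⟩
  clear hb
  induction hr with
  | refl => exact .refl
  | tail _ hs ih =>
    obtain ⟨d, hdG, rfl, rfl⟩ := hs
    by_cases hdF : d ∈ F
    · exact ih.tail ⟨d, hdF, rfl, rfl⟩
    · rcases hd d hdG hdF with ⟨c, rfl, h'⟩ | h'
      · exact h'
      · exact (h' ⟨_, rfl, ih⟩).elim

/-- The event that `B` can be reached from `a` along directed edges in `K` that are open, that is,
at which the configuration agrees with `o`. -/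
def reachEvent (o : DEdge → Bool) (K : Set DEdge) (a : ℤ × ℤ) (B : Set (ℤ × ℤ)) :
    Set (DEdge → Bool) :=
  {η | Reach {d ∈ K | η d = o d} a B}

lemma inc_reachEvent (o : DEdge → Bool) (K : Set DEdge) (a : ℤ × ℤ) (B : Set (ℤ × ℤ)) :
    Inc o (reachEvent o K a B) := by
  refine ⟨{F | (F : Set DEdge) ⊆ K ∧ Reach F a B}, ?_⟩
  ext η
  constructor
  · intro h
    obtain ⟨G, hG, hr⟩ := Reach.exists_finset h
    exact ⟨G, ⟨fun d hd => (hG hd).1, hr⟩, fun d hd => (hG hd).2⟩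
  · rintro ⟨F, ⟨hF, hr⟩, h⟩
    exact hr.mono fun d hd => ⟨hF hd, h d hd⟩

/-- Replace directed edges over edges in `J` by their positive versions. -/
def merge (J : Finset Edge) (d : DEdge) : DEdge := if d.1 ∈ J then (d.1, true) else d

/-- Reverse the directed edges over `e`. -/
def flipAt (e : Edge) (d : DEdge) : DEdge := if d.1 = e then (d.1, !d.2) else d

lemma flipAt_involutive (e : Edge) : Function.Involutive (flipAt e) := by
  rintro ⟨f, b⟩
  by_cases h : f = e <;> simp [flipAt, h]

lemma merge_of_ne {J : Finset Edge} {e : Edge} {d : DEdge} (hd : d.1 ≠ e) :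
    merge (insert e J) d = merge J d := by
  simp [merge, hd]

lemma flipAt_merge_of_ne {J : Finset Edge} {e : Edge} {d : DEdge} (hd : d.1 ≠ e) :
    flipAt e (merge J d) = merge J d := by
  unfold merge flipAt
  split_ifs <;> simp_all

section Decoupling

variable (p : unitInterval) (o : DEdge → Bool) (K : Set DEdge) (a : ℤ × ℤ) (B : Set (ℤ × ℤ))

lemma measurable_merge (J : Finset Edge) :
    Measurable fun (η : DEdge → Bool) d => η (merge J d) := by fun_prop

/-- Given the state of all other edges, reachability depends on at most one of the two directions
of the edge `e`, so it does not matter whether the two directions are independent or tied. -/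
lemma measure_reachEvent_merge_insert {J : Finset Edge} {e : Edge} (he : e ∉ J) :
    bits DEdge p {η | (fun d => η (merge (insert e J) d)) ∈ reachEvent o K a B}
      = bits DEdge p {η | (fun d => η (merge J d)) ∈ reachEvent o K a B} := by
  let K' : Set DEdge := {d ∈ K | d.1 ≠ e}
  let C : (ℤ × ℤ) → Set (DEdge → Bool) :=
    fun v => {η | (fun d => η (merge J d)) ∈ reachEvent o K' a {v}}
  let W : Set (DEdge → Bool) := (C (src (e, true)))ᶜ ∩ C (dst (e, true))
  set E' : Set (DEdge → Bool) :=
    {η | (fun d => η (merge (insert e J) d)) ∈ reachEvent o K a B} with hE'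
  set E : Set (DEdge → Bool) := {η | (fun d => η (merge J d)) ∈ reachEvent o K a B} with hE
  have hmE : MeasurableSet E := measurable_merge J (inc_reachEvent o K a B).measurableSet
  have hmC : ∀ v, MeasurableSet (C v) := fun v =>
    measurable_merge J (inc_reachEvent o K' a {v}).measurableSet
  have hmW : MeasurableSet W := (hmC _).compl.inter (hmC _)
  have hflip : MeasurePreserving (fun (η : DEdge → Bool) d => η (flipAt e d)) (bits DEdge p)
      (bits DEdge p) := measurePreserving_comp p (flipAt_involutive e).injective
  have hCflip : ∀ v η, (fun d => η (flipAt e d)) ∈ C v ↔ η ∈ C v := by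
    intro v η
    have : {d ∈ K' | η (flipAt e (merge J d)) = o d} = {d ∈ K' | η (merge J d) = o d} := by
      ext d
      simp only [Set.mem_ofPred_eq]
      refine and_congr_right fun hd => ?_
      rw [flipAt_merge_of_ne hd.2]
    change Reach _ _ _ ↔ Reach _ _ _
    rw [this]
  have hWflip : ∀ η, (fun d => η (flipAt e d)) ∈ W ↔ η ∈ W := fun η =>
    and_congr (not_congr (hCflip _ η)) (hCflip _ η)
  have hmerge : ∀ b, merge J (e, b) = (e, b) := fun b => by simp [merge, he]
  have hmerge' : ∀ b, merge (insert e J) (e, b) = (e, true) := fun b => by simp [merge]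
  -- If two configurations agree off `e` and in the only relevant direction of `e`,
  -- then they have the same reachability.
  have hrel : ∀ (η η' : DEdge → Bool) (b : Bool), (∀ d, d.1 ≠ e → η d = η' d) →
      η (e, b) = η' (e, b) →
      (Reach {d ∈ K' | η d = o d} a {dst (e, !b)} ∨
        ¬ Reach {d ∈ K' | η d = o d} a {src (e, !b)}) →
      (Reach {d ∈ K | η d = o d} a B ↔ Reach {d ∈ K | η' d = o d} a B) := by
    intro η η' b h1 h2 h3
    let F : Set DEdge := {d ∈ K | (d.1 ≠ e ∨ d = (e, b)) ∧ η d = o d}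
    have hKF : {d ∈ K' | η d = o d} ⊆ F := fun d hd => ⟨hd.1.1, Or.inl hd.1.2, hd.2⟩
    have hF' : F = {d ∈ K | (d.1 ≠ e ∨ d = (e, b)) ∧ η' d = o d} := by
      ext d
      refine and_congr_right fun _ => and_congr_right fun h => ?_
      rcases h with h | rfl
      · rw [h1 d h]
      · rw [h2]
    have h3' : Reach F a {dst (e, !b)} ∨ ¬ Reach F a {src (e, !b)} := by
      rcases h3 with h3 | h3
      · exact Or.inl (h3.mono hKF)
      · by_cases h4 : Reach {d ∈ K' | η d = o d} a {src (e, b)}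
        · left
          have : dst (e, !b) = src (e, b) := by cases b <;> rfl
          rw [this]
          exact h4.mono hKF
        · right
          rwa [reach_iff_of_dst hKF]
          rintro d ⟨hd, hd', hd''⟩ hdn
          rcases hd' with hd' | rfl
          · exact (hdn ⟨⟨hd, hd'⟩, hd''⟩).elim
          · exact Or.inr h4
    have hgen : ∀ ζ : DEdge → Bool, F = {d ∈ K | (d.1 ≠ e ∨ d = (e, b)) ∧ ζ d = o d} →
        (Reach {d ∈ K | ζ d = o d} a B ↔ Reach F a B) := by
      intro ζ hζ
      refine reach_iff_of_dst (by rw [hζ]; exact fun d hd => ⟨hd.1, hd.2.2⟩) ?_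
      rintro ⟨f, c⟩ ⟨hd, hd'⟩ hdn
      rw [hζ] at hdn
      have hf : f = e := by
        by_contra hf
        exact hdn ⟨hd, Or.inl hf, hd'⟩
      subst hf
      have hc : c = !b := by
        by_contra hc
        have : c = b := by cases b <;> cases c <;> simp_all
        exact hdn ⟨hd, Or.inr (by rw [this]), hd'⟩
      rw [hc]
      exact h3'
    rw [hgen η rfl, hgen η' hF']
  have hout : ∀ η, η ∉ W → (η ∈ E' ↔ η ∈ E) := by
    intro η hη
    have hη' : η ∈ C (src (e, true)) ∨ η ∉ C (dst (e, true)) := by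
      by_contra! h
      exact hη h
    refine (hrel _ _ true ?_ ?_ ?_).symm
    · intro d hd; rw [merge_of_ne hd]
    · rw [hmerge, hmerge']
    · exact hη'
  have hin : ∀ η, η ∈ W → (η ∈ E' ↔ (fun d => η (flipAt e d)) ∈ E) := by
    intro η hη
    refine (hrel _ _ false ?_ ?_ ?_).symm
    · intro d hd
      change η (flipAt e (merge J d)) = _
      rw [merge_of_ne hd, flipAt_merge_of_ne hd]
    · rw [hmerge, hmerge']; simp [flipAt]
    · exact Or.inl ((hCflip _ η).2 hη.2)
  rw [← measure_inter_add_sdiff E' hmW, ← measure_inter_add_sdiff E hmW]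
  congr 1
  · rw [← hflip.measure_preimage (hmE.inter hmW).nullMeasurableSet]
    congr 1
    ext η
    constructor
    · rintro ⟨h1, h2⟩; exact ⟨(hin η h2).1 h1, (hWflip η).2 h2⟩
    · rintro ⟨h1, h2⟩
      have h2' := (hWflip η).1 h2
      exact ⟨(hin η h2').2 h1, h2'⟩
  · congr 1
    ext η
    exact and_congr_left fun h => hout η h

lemma measure_reachEvent_merge (J : Finset Edge) :
    bits DEdge p {η | (fun d => η (merge J d)) ∈ reachEvent o K a B}
      = bits DEdge p (reachEvent o K a B) := by
  induction J using Finset.induction_on with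
  | empty =>
    have : ∀ d, merge ∅ d = d := fun d => by simp [merge]
    simp only [this]; rfl
  | insert e J he ih => rw [measure_reachEvent_merge_insert p o K a B he, ih]

/-- Reachability is at most as likely for a random orientation as it is when the two directions of
each edge are independent. -/
lemma measure_reachEvent_orientation_le :
    bits Edge p {ω | (fun d : DEdge => ω d.1) ∈ reachEvent o K a B}
      ≤ bits DEdge p (reachEvent o K a B) := by
  classical
  have hmp : MeasurePreserving (fun (η : DEdge → Bool) (e : Edge) => η (e, true)) (bits DEdge p)
      (bits Edge p) := measurePreserving_comp p (fun e f h => by simpa using h)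
  have hm : MeasurableSet {ω : Config | (fun d : DEdge => ω d.1) ∈ reachEvent o K a B} :=
    (by fun_prop : Measurable fun (ω : Config) (d : DEdge) => ω d.1)
      (inc_reachEvent o K a B).measurableSet
  rw [← hmp.measure_preimage hm.nullMeasurableSet]
  let Kn : ℕ → Set DEdge := fun n => {d ∈ K | Encodable.encode d ≤ n}
  let s : ℕ → Set (DEdge → Bool) :=
    fun n => {η | (fun d : DEdge => η (d.1, true)) ∈ reachEvent o (Kn n) a B}
  have hs : Monotone s := by
    intro m n hmn η h
    exact Reach.mono (fun d hd => ⟨⟨hd.1.1, hd.1.2.trans hmn⟩, hd.2⟩) h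
  have hU : (fun (η : DEdge → Bool) (e : Edge) => η (e, true)) ⁻¹'
      {ω | (fun d : DEdge => ω d.1) ∈ reachEvent o K a B} ⊆ ⋃ n, s n := by
    intro η h
    obtain ⟨G, hG, hr⟩ := Reach.exists_finset h
    refine Set.mem_iUnion.2 ⟨G.sup Encodable.encode, hr.mono fun d hd => ?_⟩
    exact ⟨⟨(hG hd).1, Finset.le_sup (f := Encodable.encode) hd⟩, (hG hd).2⟩
  refine (measure_mono hU).trans (le_of_tendsto' (tendsto_measure_iUnion_atTop hs) fun n => ?_)
  have hfin : (Kn n).Finite := by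
    refine Set.Finite.of_finite_image (f := Encodable.encode) ?_ Encodable.encode_injective.injOn
    exact (Set.finite_Iic n).subset (by rintro _ ⟨F, hF, rfl⟩; exact hF.2)
  have hsn : s n = {η | (fun d => η (merge (hfin.toFinset.image Prod.fst) d))
      ∈ reachEvent o (Kn n) a B} := by
    ext η
    change Reach _ _ _ ↔ Reach _ _ _
    have : {d ∈ Kn n | η (d.1, true) = o d}
        = {d ∈ Kn n | η (merge (hfin.toFinset.image Prod.fst) d) = o d} := by
      ext d
      refine and_congr_right fun hd => ?_
      have : d.1 ∈ hfin.toFinset.image Prod.fst :=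
        Finset.mem_image_of_mem _ (hfin.mem_toFinset.2 hd)
      rw [merge, if_pos this]
    rw [this]
  rw [Function.comp_apply, hsn, measure_reachEvent_merge]
  exact measure_mono fun η h => Reach.mono (fun d hd => ⟨hd.1.1, hd.2⟩) h

end Decoupling

/-! ### Crossing a vertical strip of the quadrant -/

/-- The open value of a directed edge in Grimmett's model. -/
def openG (d : DEdge) : Bool := d.2

/-- The open value of a directed edge in the H-model. -/
def openH (d : DEdge) : Bool := decide (normSq (src d) < normSq (dst d))

lemma gStep_iff {ω : Config} {u v : ℤ × ℤ} :
    gStep ω u v ↔ ∃ d : DEdge, ω d.1 = openG d ∧ src d = u ∧ dst d = v := by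
  constructor
  · rintro ⟨e, ⟨h1, h2, h3⟩ | ⟨h1, h2, h3⟩⟩
    · exact ⟨(e, true), h3, h1, h2⟩
    · exact ⟨(e, false), h3, h2, h1⟩
  · rintro ⟨⟨e, b⟩, h1, h2, h3⟩
    cases b
    · exact ⟨e, Or.inr ⟨h3, h2, h1⟩⟩
    · exact ⟨e, Or.inl ⟨h2, h3, h1⟩⟩

lemma hStep_iff {ω : Config} {u v : ℤ × ℤ} :
    hStep ω u v ↔ ∃ d : DEdge, ω d.1 = openH d ∧ src d = u ∧ dst d = v := by
  constructor
  · rintro ⟨e, ⟨rfl, rfl⟩ | ⟨rfl, rfl⟩, h3⟩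
    · exact ⟨(e, true), h3, rfl, rfl⟩
    · exact ⟨(e, false), h3, rfl, rfl⟩
  · rintro ⟨⟨e, b⟩, h1, rfl, rfl⟩
    cases b
    · exact ⟨e, Or.inr ⟨rfl, rfl⟩, h1⟩
    · exact ⟨e, Or.inl ⟨rfl, rfl⟩, h1⟩

/-- Every directed edge is of one of the four kinds right, left, up, down. -/
lemma DEdge.cases {P : DEdge → Prop} (right : ∀ x y, P (((x, y), false), true))
    (left : ∀ x y, P (((x, y), false), false)) (up : ∀ x y, P (((x, y), true), true))
    (down : ∀ x y, P (((x, y), true), false)) (d : DEdge) : P d := by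
  obtain ⟨⟨⟨x, y⟩, c⟩, b⟩ := d
  cases c <;> cases b
  · exact left x y
  · exact right x y
  · exact down x y
  · exact up x y

@[simp] lemma src_right (x y : ℤ) : src (((x, y), false), true) = (x, y) := rfl
@[simp] lemma src_left (x y : ℤ) : src (((x, y), false), false) = (x + 1, y) := rfl
@[simp] lemma src_up (x y : ℤ) : src (((x, y), true), true) = (x, y) := rfl
@[simp] lemma src_down (x y : ℤ) : src (((x, y), true), false) = (x, y + 1) := rfl
@[simp] lemma dst_right (x y : ℤ) : dst (((x, y), false), true) = (x + 1, y) := rfl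
@[simp] lemma dst_left (x y : ℤ) : dst (((x, y), false), false) = (x, y) := rfl
@[simp] lemma dst_up (x y : ℤ) : dst (((x, y), true), true) = (x, y + 1) := rfl
@[simp] lemma dst_down (x y : ℤ) : dst (((x, y), true), false) = (x, y) := rfl

lemma mem_NEquad {v : ℤ × ℤ} : v ∈ NEquad ↔ 0 ≤ v.1 ∧ 0 ≤ v.2 := Iff.rfl

/-- The directed edges of the North-East quadrant that start in the strip of width `N`. -/
def stripEdges (N : ℕ) : Set DEdge := {d | src d ∈ NEquad ∧ dst d ∈ NEquad ∧ (src d).1 < N}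

/-- The event that the strip of width `N` can be crossed from the origin. -/
def stripEvent (N : ℕ) : Set (DEdge → Bool) :=
  reachEvent openG (stripEdges N) (0, 0) {v | (N : ℤ) ≤ v.1}

lemma stripEvent_of_percolates {N : ℕ} {ω : Config} (hω : percolates (gStep ω) NEquad)
    {b : ℕ} (hb : ∀ a : ℕ, a < N → ω (((a : ℤ), (b : ℤ)), true) = false) :
    (fun d : DEdge => ω d.1) ∈ stripEvent N := by
  obtain ⟨γ, h0, hinj, hstep, hmem⟩ := hω
  by_contra hno
  have key : ∀ n, Relation.ReflTransGen (fun u v => ∃ d ∈ {d ∈ stripEdges N | ω d.1 = openG d},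
      src d = u ∧ dst d = v) (0, 0) (γ n) ∧ (γ n).1 < N ∧ (γ n).2 ≤ b := by
    intro n
    induction n with
    | zero =>
      refine ⟨by rw [h0], ?_, by simp [h0]⟩
      by_contra! h
      exact hno ⟨γ 0, h, by rw [h0]⟩
    | succ n ih =>
      obtain ⟨ih1, ih2, ih3⟩ := ih
      obtain ⟨d, hd, hs, ht⟩ := gStep_iff.1 (hstep n)
      have hd' : d ∈ {d ∈ stripEdges N | ω d.1 = openG d} :=
        ⟨⟨hs ▸ hmem n, ht ▸ hmem (n + 1), hs ▸ ih2⟩, hd⟩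
      have hr := ih1.tail ⟨d, hd', hs, ht⟩
      refine ⟨hr, ?_, ?_⟩
      · by_contra! h
        exact hno ⟨_, h, hr⟩
      · by_contra! h
        have hm := hmem n
        rw [mem_NEquad] at hm
        rw [← hs] at ih2 ih3 hm
        rw [← ht] at h
        clear hd' hr hs ht
        revert hd ih2 ih3 h hm
        induction d using DEdge.cases with
        | up x y =>
          simp only [src_up, dst_up]
          intro h2 h1 hd h3 h4
          have hy : y = b := by omega
          obtain ⟨a, rfl⟩ := Int.eq_ofNat_of_zero_le h4.1
          rw [hy, hb a (by exact_mod_cast h1)] at hd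
          exact absurd hd (by simp [openG])
        | right x y => simp; omega
        | left x y => simp; omega
        | down x y => simp; omega
  have hfin : (Set.range γ).Finite := by
    refine (Set.finite_Icc ((0 : ℤ), (0 : ℤ)) ((N : ℤ), (b : ℤ))).subset ?_
    rintro _ ⟨n, rfl⟩
    have := hmem n
    rw [mem_NEquad] at this
    exact ⟨⟨this.1, this.2⟩, ⟨(key n).2.1.le, (key n).2.2⟩⟩
  exact Set.infinite_range_of_injective hinj hfin

lemma bits_cylinder_false (I : Type*) (p : unitInterval) (F : Finset I) :
    bits I p {ω | ∀ i ∈ F, ω i = false} = ENNReal.ofReal (1 - p) ^ F.card := by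
  have := Measure.infinitePi_pi (fun _ : I => bern p) (s := F) (t := fun _ => {false})
    (fun _ _ => MeasurableSet.of_discrete)
  rw [Finset.prod_congr rfl (fun i _ => bern_false p), Finset.prod_const] at this
  rw [← this]
  rfl

/-- The vertical edges at height `b` over the strip of width `N`. -/
def level (N : ℕ) (b : ℕ) : Finset Edge :=
  (Finset.range N).image fun a : ℕ => (((a : ℤ), (b : ℤ)), true)

lemma card_level (N b : ℕ) : (level N b).card = N := by
  rw [level, Finset.card_image_of_injective _ (fun a a' h => by simpa using h), Finset.card_range]

lemma disjoint_level {N b b' : ℕ} (h : b ≠ b') :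
    Disjoint (level N b : Set Edge) (level N b' : Set Edge) := by
  rw [Finset.disjoint_coe, Finset.disjoint_left]
  simp only [level, Finset.mem_image]
  rintro _ ⟨a, -, rfl⟩ ⟨a', -, h'⟩
  simp at h'
  omega

/-- Almost surely some level of the strip is entirely directed downwards. -/
lemma measure_forall_level (p : unitInterval) (hp : p < 1) (N : ℕ) :
    bits Edge p {ω | ∀ b, ¬ ∀ e ∈ level N b, ω e = false} = 0 := by
  set L : ℕ → Set Config := fun b => {ω | ∀ e ∈ level N b, ω e = false}
  have hLm : ∀ b, MeasurableSet (L b) := fun b => measurableSet_cylinder_eq (fun _ => false) _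
  have hp' : (p : ℝ) < 1 := hp
  have hL : ∀ b, bits Edge p (L b)ᶜ = 1 - ENNReal.ofReal (1 - p) ^ N := fun b => by
    rw [prob_compl_eq_one_sub (hLm b), bits_cylinder_false, card_level]
  have hLd : ∀ b, DependsOnCoords (L b)ᶜ (level N b) := fun b ω ω' h =>
    not_congr (forall₂_congr fun e he => by rw [h e he])
  let G : ℕ → Set Config := fun n => ⋂ b < n, (L b)ᶜ
  have hGm : ∀ n, MeasurableSet (G n) := fun n =>
    MeasurableSet.iInter fun b => MeasurableSet.iInter fun _ => (hLm b).compl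
  have hG : ∀ n, bits Edge p (G n) = (1 - ENNReal.ofReal (1 - p) ^ N) ^ n := by
    intro n
    induction n with
    | zero => simp [G]
    | succ n ih =>
      have hsucc : G (n + 1) = G n ∩ (L n)ᶜ := by
        ext ω
        simp only [G, Set.mem_iInter, Set.mem_inter_iff, Nat.forall_lt_succ_right]
      have hGd : DependsOnCoords (G n) (⋃ b < n, (level N b : Set Edge)) := by
        intro ω ω' h
        simp only [G, Set.mem_iInter]
        refine forall₂_congr fun b hb => hLd b ω ω' fun e he => h e ?_
        exact Set.mem_iUnion₂.2 ⟨b, hb, he⟩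
      rw [hsucc, hGd.measure_inter p (hGm n) (hLm n).compl (hLd n), ih, hL, pow_succ]
      rw [Set.disjoint_iUnion₂_left]
      exact fun b hb => disjoint_level hb.ne
  have hlt : 1 - ENNReal.ofReal (1 - p) ^ N < 1 := by
    refine ENNReal.sub_lt_self (by simp) (by simp) (pow_ne_zero _ ?_)
    simp [hp']
  refine le_antisymm (ge_of_tendsto' (ENNReal.tendsto_pow_atTop_nhds_zero_of_lt_one hlt)
    fun n => ?_) zero_le
  rw [← hG n]
  refine measure_mono fun ω h => ?_
  simp only [G, Set.mem_iInter]
  exact fun b _ => h b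

lemma thetaNE_le_stripEvent (p : unitInterval) (hp : p < 1) (N : ℕ) :
    thetaNE p ≤ bits DEdge p (stripEvent N) := by
  refine le_trans ?_ (measure_reachEvent_orientation_le p _ _ _ _)
  rw [thetaNE, mu_eq_bits]
  calc bits Edge p {ω | percolates (gStep ω) NEquad}
      ≤ bits Edge p ({ω | (fun d : DEdge => ω d.1) ∈ stripEvent N}
          ∪ {ω | ∀ b, ¬ ∀ e ∈ level N b, ω e = false}) := by
        refine measure_mono fun ω hω => ?_
        by_cases h : ∀ b, ¬ ∀ e ∈ level N b, ω e = false
        · exact Or.inr h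
        · push Not at h
          obtain ⟨b, hb⟩ := h
          refine Or.inl (stripEvent_of_percolates hω (b := b) fun a ha => hb _ ?_)
          exact Finset.mem_image_of_mem _ (Finset.mem_range.2 ha)
    _ ≤ _ := (measure_union_le _ _).trans (by rw [measure_forall_level p hp, add_zero]; rfl)

/-! ### Closed sets -/

/-- The blocked value of a directed edge in the H-model. -/
def blockH (d : DEdge) : Bool := !openH d

lemma blockH_of_NEquad {d : DEdge} (hs : src d ∈ NEquad) (ht : dst d ∈ NEquad) :
    blockH d = !d.2 := by
  revert hs ht
  induction d using DEdge.cases <;>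
    · simp only [mem_NEquad, src_right, src_left, src_up, src_down, dst_right, dst_left, dst_up,
        dst_down, blockH, openH, normSq]
      intro hs ht
      simp
      nlinarith

/-- All directed edges of the region `R` that leave `S` are blocked. -/
def ClosedIn (η : DEdge → Bool) (R : Set (ℤ × ℤ)) (S : Finset (ℤ × ℤ)) : Prop :=
  ∀ d, src d ∈ S → dst d ∈ R → dst d ∉ S → η d = blockH d

/-- The event that some finite subset of `R` with property `P` is closed in `R`. -/
def closedEvent (R : Set (ℤ × ℤ)) (P : Finset (ℤ × ℤ) → Prop) : Set (DEdge → Bool) :=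
  {η | ∃ S : Finset (ℤ × ℤ), (S : Set (ℤ × ℤ)) ⊆ R ∧ P S ∧ ClosedIn η R S}

lemma finite_src_mem (S : Finset (ℤ × ℤ)) : {d : DEdge | src d ∈ S}.Finite := by
  have : Function.Injective fun d : DEdge => (src d, d.1.2, d.2) := by
    rintro ⟨⟨⟨x, y⟩, c⟩, b⟩ ⟨⟨⟨x', y'⟩, c'⟩, b'⟩ h
    cases b <;> cases c <;> cases b' <;> cases c' <;> simp at h ⊢ <;> exact h
  refine Set.Finite.of_finite_image (f := fun d : DEdge => (src d, d.1.2, d.2)) ?_ this.injOn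
  refine ((S ×ˢ (Finset.univ : Finset (Bool × Bool))).finite_toSet).subset ?_
  rintro _ ⟨d, hd, rfl⟩
  simpa using hd

lemma inc_closedEvent (R : Set (ℤ × ℤ)) (P : Finset (ℤ × ℤ) → Prop) :
    Inc blockH (closedEvent R P) := by
  refine ⟨{F | ∃ S : Finset (ℤ × ℤ), (S : Set (ℤ × ℤ)) ⊆ R ∧ P S ∧
    ∀ d, d ∈ F ↔ (src d ∈ S ∧ dst d ∈ R ∧ dst d ∉ S)}, ?_⟩
  ext η
  constructor
  · rintro ⟨S, hR, hP, h⟩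
    have hfin : {d : DEdge | src d ∈ S ∧ dst d ∈ R ∧ dst d ∉ S}.Finite :=
      (finite_src_mem S).subset fun d hd => hd.1
    refine ⟨hfin.toFinset, ⟨S, hR, hP, fun d => hfin.mem_toFinset⟩, fun d hd => ?_⟩
    obtain ⟨h1, h2, h3⟩ := hfin.mem_toFinset.1 hd
    exact h d h1 h2 h3
  · rintro ⟨F, ⟨S, hR, hP, hF⟩, h⟩
    exact ⟨S, hR, hP, fun d h1 h2 h3 => h d ((hF d).2 ⟨h1, h2, h3⟩)⟩

lemma ClosedIn.union {η : DEdge → Bool} {R : Set (ℤ × ℤ)} {S T : Finset (ℤ × ℤ)}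
    (hS : ClosedIn η R S) (hT : ClosedIn η R T) : ClosedIn η R (S ∪ T) := by
  intro d h1 h2 h3
  simp only [Finset.mem_union, not_or] at h1 h3
  exact h1.elim (fun h => hS d h h2 h3.1) (fun h => hT d h h2 h3.2)

lemma ClosedIn.inter {η : DEdge → Bool} {R : Set (ℤ × ℤ)} {S T : Finset (ℤ × ℤ)}
    (hS : ClosedIn η R S) (hT : ClosedIn η R T) : ClosedIn η R (S ∩ T) := by
  intro d h1 h2 h3
  simp only [Finset.mem_inter, not_and_or] at h1 h3
  exact h3.elim (fun h => hS d h1.1 h2 h) (fun h => hT d h1.2 h2 h)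

/-! ### Walls from the horizontal axis to the vertical axis -/

/-- The part of the North-East quadrant at height at least `k`. -/
def upperQuad (k : ℤ) : Set (ℤ × ℤ) := {v | 0 ≤ v.1 ∧ k ≤ v.2}

/-- The trace on the bottom line of `upperQuad k` is `[0, N)` and the trace on the vertical axis is
an initial segment. -/
def WallAt (k N : ℤ) (S : Finset (ℤ × ℤ)) : Prop :=
  (∀ x, 0 ≤ x → ((x, k) ∈ S ↔ x < N)) ∧ ∃ m, ∀ y, k ≤ y → ((0, y) ∈ S ↔ y < m)

/-- The edge of the H-model that corresponds by duality to an edge of Grimmett's model. -/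
def dualEdge (k N : ℤ) (e : Edge) : Edge :=
  if e.2 then ((N - 1 - e.1.1, k + e.1.2 + 1), false) else ((N - 1 - e.1.1, k + e.1.2), true)

def dualDEdge (k N : ℤ) (d : DEdge) : DEdge := (dualEdge k N d.1, d.2)

lemma dualDEdge_injective (k N : ℤ) : Function.Injective (dualDEdge k N) := by
  rintro ⟨⟨⟨x, y⟩, c⟩, b⟩ ⟨⟨⟨x', y'⟩, c'⟩, b'⟩ h
  cases c <;> cases c' <;> simp [dualDEdge, dualEdge] at h ⊢ <;> omega

/-- The jump carried by the dual path that currently ends at `(a, b)`. -/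
def jump (k N a b x y : ℤ) : ℤ := if x ≤ N - 1 - a ∧ k + b < y then 1 else 0

/-- A function that does not increase along unblocked edges, except for a jump of the horizontal
edges along a half-line starting at the end `(a, b)` of a dual path. -/
structure Potential (η : DEdge → Bool) (k N a b : ℤ) (w : ℤ → ℤ → ℤ) : Prop where
  up : ∀ x y, 0 ≤ x → k ≤ y → η (((x, y), true), true) = true → w x (y + 1) ≤ w x y
  down : ∀ x y, 0 ≤ x → k ≤ y → η (((x, y), true), false) = false → w x y ≤ w x (y + 1)
  right : ∀ x y, 0 ≤ x → k ≤ y → η (((x, y), false), true) = true →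
    w (x + 1) y + jump k N a b (x + 1) y ≤ w x y + jump k N a b x y
  left : ∀ x y, 0 ≤ x → k ≤ y → η (((x, y), false), false) = false →
    w x y + jump k N a b x y ≤ w (x + 1) y + jump k N a b (x + 1) y
  bottom : ∀ x, 0 ≤ x → w x k = if N ≤ x then 1 else 0
  far_right : ∀ x y, N ≤ x → k ≤ y → w x y = 1
  far_up : ∃ Y, ∀ x y, 0 ≤ x → Y < y → w x y + jump k N a b x y = 1
  axis : ∀ y, k ≤ y → w 0 y = if a = N ∧ k + b < y then 1 else 0

lemma Potential.base {η : DEdge → Bool} {k N : ℤ} (hN : 1 ≤ N)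
    (h : η (((N - 1, k), false), true) = false) :
    Potential η k N 0 0 fun x _ => if N ≤ x then 1 else 0 where
  up := by intros; rfl
  down := by intros; rfl
  right := by
    intro x y hx hy hη
    have : ¬ (x = N - 1 ∧ y = k) := by
      rintro ⟨rfl, rfl⟩
      simp [h] at hη
    simp only [jump]
    grind
  left := by
    intro x y hx hy hη
    simp only [jump]
    grind
  bottom := by intros; rfl
  far_right := by intro x y hx hy; simp [hx]
  far_up := ⟨k, by intro x y hx hy; simp only [jump]; grind⟩
  axis := by intro y hy; grind

lemma Potential.step_right {η : DEdge → Bool} {k N a b : ℤ} {w : ℤ → ℤ → ℤ} (ha : 0 ≤ a)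
    (hb : 0 ≤ b) (hN : a < N) (hd : η (((N - 1 - a, k + b), true), true) = false)
    (hw : Potential η k N a b w) :
    Potential η k N (a + 1) b
      fun x y => w x y + if x = N - 1 - a ∧ k + b < y then 1 else 0 where
  up := by
    intro x y hx hy h
    have := hw.up x y hx hy h
    have hne : ¬ (x = N - 1 - a ∧ y = k + b) := by
      rintro ⟨rfl, rfl⟩
      simp [hd] at h
    grind
  down := by
    intro x y hx hy h
    have := hw.down x y hx hy h
    grind
  right := by
    intro x y hx hy h
    have := hw.right x y hx hy h
    simp only [jump] at this ⊢
    grind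
  left := by
    intro x y hx hy h
    have := hw.left x y hx hy h
    simp only [jump] at this ⊢
    grind
  bottom := by
    intro x hx
    have := hw.bottom x hx
    grind
  far_right := by
    intro x y hx hy
    have := hw.far_right x y hx hy
    grind
  far_up := by
    obtain ⟨Y, hY⟩ := hw.far_up
    refine ⟨Y, fun x y hx hy => ?_⟩
    have := hY x y hx hy
    simp only [jump] at this ⊢
    grind
  axis := by
    intro y hy
    have := hw.axis y hy
    grind

lemma Potential.step_left {η : DEdge → Bool} {k N a b : ℤ} {w : ℤ → ℤ → ℤ} (ha : 0 ≤ a)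
    (hb : 0 ≤ b) (hN : a + 1 < N) (hd : η (((N - 1 - a, k + b), true), false) = true)
    (hw : Potential η k N (a + 1) b w) :
    Potential η k N a b
      fun x y => w x y - if x = N - 1 - a ∧ k + b < y then 1 else 0 where
  up := by
    intro x y hx hy h
    have := hw.up x y hx hy h
    grind
  down := by
    intro x y hx hy h
    have := hw.down x y hx hy h
    have hne : ¬ (x = N - 1 - a ∧ y = k + b) := by
      rintro ⟨rfl, rfl⟩
      simp [hd] at h
    grind
  right := by
    intro x y hx hy h
    have := hw.right x y hx hy h
    simp only [jump] at this ⊢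
    grind
  left := by
    intro x y hx hy h
    have := hw.left x y hx hy h
    simp only [jump] at this ⊢
    grind
  bottom := by
    intro x hx
    have := hw.bottom x hx
    grind
  far_right := by
    intro x y hx hy
    have := hw.far_right x y hx hy
    grind
  far_up := by
    obtain ⟨Y, hY⟩ := hw.far_up
    refine ⟨Y, fun x y hx hy => ?_⟩
    have := hY x y hx hy
    simp only [jump] at this ⊢
    grind
  axis := by
    intro y hy
    have := hw.axis y hy
    grind

lemma Potential.step_up {η : DEdge → Bool} {k N a b : ℤ} {w : ℤ → ℤ → ℤ} (hN : a < N)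
    (hd : η (((N - 1 - a, k + b + 1), false), true) = false)
    (hw : Potential η k N a b w) : Potential η k N a (b + 1) w where
  up := hw.up
  down := hw.down
  right := by
    intro x y hx hy h
    have := hw.right x y hx hy h
    have hne : ¬ (x = N - 1 - a ∧ y = k + b + 1) := by
      rintro ⟨rfl, rfl⟩
      simp [hd] at h
    simp only [jump] at this ⊢
    grind
  left := by
    intro x y hx hy h
    have := hw.left x y hx hy h
    simp only [jump] at this ⊢
    grind
  bottom := hw.bottom
  far_right := hw.far_right
  far_up := by
    obtain ⟨Y, hY⟩ := hw.far_up
    refine ⟨max Y (k + b + 1), fun x y hx hy => ?_⟩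
    have := hY x y hx (by omega)
    simp only [jump] at this ⊢
    grind
  axis := by
    intro y hy
    have := hw.axis y hy
    grind

lemma Potential.step_down {η : DEdge → Bool} {k N a b : ℤ} {w : ℤ → ℤ → ℤ} (hN : a < N)
    (hd : η (((N - 1 - a, k + b + 1), false), false) = true)
    (hw : Potential η k N a (b + 1) w) : Potential η k N a b w where
  up := hw.up
  down := hw.down
  right := by
    intro x y hx hy h
    have := hw.right x y hx hy h
    simp only [jump] at this ⊢
    grind
  left := by
    intro x y hx hy h
    have := hw.left x y hx hy h
    have hne : ¬ (x = N - 1 - a ∧ y = k + b + 1) := by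
      rintro ⟨rfl, rfl⟩
      simp [hd] at h
    simp only [jump] at this ⊢
    grind
  bottom := hw.bottom
  far_right := hw.far_right
  far_up := by
    obtain ⟨Y, hY⟩ := hw.far_up
    refine ⟨max Y (k + b + 1), fun x y hx hy => ?_⟩
    have := hY x y hx (by omega)
    simp only [jump] at this ⊢
    grind
  axis := by
    intro y hy
    have := hw.axis y hy
    grind

lemma Potential.step {η : DEdge → Bool} {k N : ℤ} {d : DEdge} {w : ℤ → ℤ → ℤ}
    (hs : src d ∈ NEquad) (ht : dst d ∈ NEquad) (hN : (src d).1 < N)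
    (hd : η (dualDEdge k N d) = !d.2) (hw : Potential η k N (src d).1 (src d).2 w) :
    ∃ w', Potential η k N (dst d).1 (dst d).2 w' := by
  induction d using DEdge.cases with
  | right a b => exact ⟨_, Potential.step_right hs.1 hs.2 hN hd hw⟩
  | left a b => exact ⟨_, Potential.step_left ht.1 ht.2 hN hd hw⟩
  | up a b => exact ⟨_, Potential.step_up hN hd hw⟩
  | down a b => exact ⟨_, Potential.step_down hN hd hw⟩

lemma Potential.exists_closed {η : DEdge → Bool} {k N b : ℤ} {w : ℤ → ℤ → ℤ} (hk : 0 ≤ k)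
    (hw : Potential η k N N b w) : η ∈ closedEvent (upperQuad k) (WallAt k N) := by
  obtain ⟨h1, h2, h3, h4, h5, h6, ⟨Y, h7⟩, h8⟩ := hw
  have hj : ∀ x y, 0 ≤ x → jump k N N b x y = 0 := by
    intro x y hx; simp only [jump]; grind
  have hfin : {v : ℤ × ℤ | 0 ≤ v.1 ∧ k ≤ v.2 ∧ w v.1 v.2 ≤ 0}.Finite := by
    refine (Set.finite_Icc ((0 : ℤ), k) (N, Y)).subset ?_
    rintro ⟨x, y⟩ ⟨hx, hy, hxy⟩
    have := h6 x y
    have := h7 x y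
    have := hj x y
    refine ⟨⟨hx, hy⟩, ?_, ?_⟩ <;> simp only at * <;> grind
  have hmem : ∀ x y, (x, y) ∈ hfin.toFinset ↔ 0 ≤ x ∧ k ≤ y ∧ w x y ≤ 0 := fun x y =>
    hfin.mem_toFinset
  refine ⟨hfin.toFinset, ?_, ⟨?_, k + b + 1, ?_⟩, ?_⟩
  · intro v hv
    have := hfin.mem_toFinset.1 hv
    exact ⟨this.1, this.2.1⟩
  · intro x hx
    rw [hmem, h5 x hx]
    grind
  · intro y hy
    rw [hmem, h8 y hy]
    grind
  · intro d hs ht ht'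
    have hs' : src d ∈ upperQuad k := ⟨(hfin.mem_toFinset.1 hs).1, (hfin.mem_toFinset.1 hs).2.1⟩
    rw [blockH_of_NEquad ⟨hs'.1, hk.trans hs'.2⟩ ⟨ht.1, hk.trans ht.2⟩]
    revert hs ht ht' hs'
    induction d using DEdge.cases with
    | up x y =>
      simp only [src_up, dst_up, hmem, upperQuad, Set.mem_ofPred_eq]
      grind
    | down x y =>
      simp only [src_down, dst_down, hmem, upperQuad, Set.mem_ofPred_eq]
      grind
    | right x y =>
      simp only [src_right, dst_right, hmem, upperQuad, Set.mem_ofPred_eq]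
      grind
    | left x y =>
      simp only [src_left, dst_left, hmem, upperQuad, Set.mem_ofPred_eq]
      grind

lemma wall_of_stripEvent {η : DEdge → Bool} {k : ℤ} {N : ℕ} (hk : 0 ≤ k) (hN : 1 ≤ N)
    (h : (fun d => !η (dualDEdge k N d)) ∈ stripEvent N)
    (h0 : η ((((N : ℤ) - 1, k), false), true) = false) :
    η ∈ closedEvent (upperQuad k) (WallAt k N) := by
  obtain ⟨z, hz, hr⟩ := h
  have key : z.1 ≤ N ∧ ∃ w, Potential η k N z.1 z.2 w := by
    clear hz
    induction hr with
    | refl => exact ⟨by simp, _, Potential.base (by exact_mod_cast hN) h0⟩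
    | tail _ h ih =>
      obtain ⟨d, ⟨⟨hs, ht, hsN⟩, hd⟩, rfl, rfl⟩ := h
      obtain ⟨w, hw⟩ := ih.2
      refine ⟨?_, hw.step hs ht hsN ?_⟩
      · revert hsN
        induction d using DEdge.cases <;> simp <;> omega
      · rw [← Bool.not_not (η _)]
        exact congrArg _ hd
  obtain ⟨hzN, w, hw⟩ := key
  rw [le_antisymm hzN hz] at hw
  exact hw.exists_closed hk

lemma inc_dual_stripEvent {k : ℤ} (N : ℕ) (hk : 0 ≤ k) :
    Inc blockH {η | (fun d => !η (dualDEdge k N d)) ∈ stripEvent N} := by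
  classical
  have hblock : ∀ d ∈ stripEdges N, blockH (dualDEdge k N d) = !d.2 := by
    intro d hd
    refine blockH_of_NEquad (d := dualDEdge k N d) ?_ ?_ <;>
    · obtain ⟨h1, h2, h3⟩ := hd
      revert h1 h2 h3
      rw [mem_NEquad, mem_NEquad, mem_NEquad]
      induction d using DEdge.cases <;> simp [dualDEdge, dualEdge] <;> omega
  refine ⟨{H | ∃ F : Finset DEdge, (F : Set DEdge) ⊆ stripEdges N ∧
    Reach F (0, 0) {v | (N : ℤ) ≤ v.1} ∧ H = F.image (dualDEdge k N)}, ?_⟩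
  ext η
  constructor
  · intro h
    obtain ⟨F, hF, hr⟩ := Reach.exists_finset h
    refine ⟨_, ⟨F, fun d hd => (hF hd).1, hr, rfl⟩, fun i hi => ?_⟩
    obtain ⟨d, hd, rfl⟩ := Finset.mem_image.1 hi
    rw [hblock d (hF hd).1, ← Bool.not_not (η _)]
    exact congrArg _ (hF hd).2
  · rintro ⟨_, ⟨F, hF, hr, rfl⟩, h⟩
    refine hr.mono fun d hd => ⟨hF hd, ?_⟩
    change (!η (dualDEdge k N d)) = d.2
    rw [h _ (Finset.mem_image_of_mem _ hd), hblock d (hF hd), Bool.not_not]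

/-- The lower bound for the probability of a wall. -/
noncomputable def wallBound (p : ℝ) : ℝ := (1 - p) * (thetaNE (1 - p)).toReal

lemma wallBound_le (p : unitInterval) (hp : 0 < p) {k : ℤ} {N : ℕ} (hk : 0 ≤ k) (hN : 1 ≤ N) :
    wallBound p ≤ (bits DEdge p).real (closedEvent (upperQuad k) (WallAt k N)) := by
  set A : Set (DEdge → Bool) := {η | (fun d => !η (dualDEdge k N d)) ∈ stripEvent N} with hA
  set e : DEdge := ((((N : ℤ) - 1, k), false), true) with he
  have heb : blockH e = false := by
    refine blockH_of_NEquad (d := e) ?_ ?_ <;> rw [mem_NEquad] <;> simp [e] <;> omega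
  have hIA : Inc blockH A := inc_dual_stripEvent N hk
  have hIB : Inc blockH {η : DEdge → Bool | η e = false} := 
    ⟨{{e}}, by ext η; simp only [Set.mem_singleton_iff, exists_eq_left, Finset.mem_singleton,
      forall_eq, heb, Set.mem_ofPred_eq]⟩
  have hmp : MeasurePreserving (fun (η : DEdge → Bool) d => !η (dualDEdge k N d)) (bits DEdge p)
      (bits DEdge (unitInterval.symm p)) :=
    (measurePreserving_not DEdge p).comp (measurePreserving_comp p (dualDEdge_injective k N))
  have hpA : (thetaNE (1 - p)).toReal ≤ (bits DEdge p).real A := by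
    have h1 : bits DEdge p A = bits DEdge (unitInterval.symm p) (stripEvent N) :=
      hmp.measure_preimage (inc_reachEvent _ _ _ _).measurableSet.nullMeasurableSet
    rw [measureReal_def, h1]
    refine ENNReal.toReal_mono (measure_ne_top _ _) ?_
    refine thetaNE_le_stripEvent (unitInterval.symm p) ?_ N
    exact Subtype.coe_lt_coe.1 (by simpa using hp)
  have hpB : (bits DEdge p).real {η : DEdge → Bool | η e = false} = 1 - p := by
    have := bits_coord DEdge p e {false}
    rw [measureReal_def, show {η : DEdge → Bool | η e = false} = {η | η e ∈ ({false} : Set Bool)}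
      from rfl, this, bern_false, ENNReal.toReal_ofReal (by linarith [p.2.2])]
  calc wallBound p
      ≤ (bits DEdge p).real {η : DEdge → Bool | η e = false} * (bits DEdge p).real A := by
        rw [hpB, wallBound]
        exact mul_le_mul_of_nonneg_left hpA (by linarith [p.2.2])
    _ ≤ _ := hIB.harris p hIA
    _ ≤ _ := measureReal_mono fun η h => wall_of_stripEvent hk hN h.2 h.1

/-! ### Symmetries -/

/-- An involutive automorphism of `ℤ²` that preserves the norm. -/
structure LatticeSymm where
  onVertex : ℤ × ℤ → ℤ × ℤ
  onEdge : DEdge → DEdge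
  onVertex_invol : Function.Involutive onVertex
  onEdge_invol : Function.Involutive onEdge
  src_onEdge : ∀ d, src (onEdge d) = onVertex (src d)
  dst_onEdge : ∀ d, dst (onEdge d) = onVertex (dst d)
  normSq_onVertex : ∀ v, normSq (onVertex v) = normSq v

namespace LatticeSymm

variable (φ : LatticeSymm)

lemma blockH_onEdge (d : DEdge) : blockH (φ.onEdge d) = blockH d := by
  simp only [blockH, openH, φ.src_onEdge, φ.dst_onEdge, φ.normSq_onVertex]

lemma mem_image {S : Finset (ℤ × ℤ)} {v : ℤ × ℤ} :
    v ∈ S.image φ.onVertex ↔ φ.onVertex v ∈ S := by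
  rw [Finset.mem_image]
  constructor
  · rintro ⟨u, hu, rfl⟩
    rwa [φ.onVertex_invol]
  · exact fun h => ⟨_, h, φ.onVertex_invol v⟩

/-- A symmetry does not decrease the probability of finding a closed set. -/
lemma le_measure_closedEvent (p : unitInterval) {R R' : Set (ℤ × ℤ)}
    {P P' : Finset (ℤ × ℤ) → Prop} (hR : ∀ v, v ∈ R' ↔ φ.onVertex v ∈ R)
    (hP : ∀ S : Finset (ℤ × ℤ), (S : Set (ℤ × ℤ)) ⊆ R → P S → P' (S.image φ.onVertex)) :
    (bits DEdge p).real (closedEvent R P) ≤ (bits DEdge p).real (closedEvent R' P') := by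
  have hmp : MeasurePreserving (fun (η : DEdge → Bool) d => η (φ.onEdge d)) (bits DEdge p)
      (bits DEdge p) := measurePreserving_comp p φ.onEdge_invol.injective
  rw [← hmp.measureReal_preimage (inc_closedEvent R P).measurableSet.nullMeasurableSet]
  refine measureReal_mono ?_
  rintro η ⟨S, hSR, hS, hcl⟩
  refine ⟨S.image φ.onVertex, fun v hv => ?_, hP S hSR hS, fun d h1 h2 h3 => ?_⟩
  · exact (hR v).2 (hSR (φ.mem_image.1 hv))
  · rw [φ.mem_image] at h1 h3
    rw [hR] at h2
    rw [← φ.src_onEdge] at h1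
    rw [← φ.dst_onEdge] at h2 h3
    have : η (φ.onEdge (φ.onEdge d)) = _ := hcl (φ.onEdge d) h1 h2 h3
    rwa [φ.onEdge_invol, φ.blockH_onEdge] at this

/-- The reflection across the diagonal. -/
def swap : LatticeSymm where
  onVertex v := (v.2, v.1)
  onEdge d := (((d.1.1.2, d.1.1.1), !d.1.2), d.2)
  onVertex_invol _ := rfl
  onEdge_invol d := by simp
  src_onEdge d := by induction d using DEdge.cases <;> rfl
  dst_onEdge d := by induction d using DEdge.cases <;> rfl
  normSq_onVertex v := by simp only [normSq]; ring

/-- The reflection across the vertical axis. -/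
def negX : LatticeSymm where
  onVertex v := (-v.1, v.2)
  onEdge d := if d.1.2 then (((-d.1.1.1, d.1.1.2), true), d.2)
    else (((-d.1.1.1 - 1, d.1.1.2), false), !d.2)
  onVertex_invol _ := by simp
  onEdge_invol d := by induction d using DEdge.cases <;> simp
  src_onEdge d := by induction d using DEdge.cases <;> simp; ring
  dst_onEdge d := by induction d using DEdge.cases <;> simp; ring
  normSq_onVertex v := by simp [normSq]

/-- The reflection across the horizontal axis. -/
def negY : LatticeSymm where
  onVertex v := (v.1, -v.2)
  onEdge d := if d.1.2 then (((d.1.1.1, -d.1.1.2 - 1), true), !d.2)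
    else (((d.1.1.1, -d.1.1.2), false), d.2)
  onVertex_invol _ := by simp
  onEdge_invol d := by induction d using DEdge.cases <;> simp
  src_onEdge d := by induction d using DEdge.cases <;> simp; ring
  dst_onEdge d := by induction d using DEdge.cases <;> simp; ring
  normSq_onVertex v := by simp [normSq]

end LatticeSymm

/-- Harris' inequality for events that together produce a third closed set. -/
lemma mul_le_measure_closedEvent (p : unitInterval) {R₁ R₂ R : Set (ℤ × ℤ)}
    {P₁ P₂ P : Finset (ℤ × ℤ) → Prop} {a b : ℝ} (hb : 0 ≤ b)
    (ha' : a ≤ (bits DEdge p).real (closedEvent R₁ P₁))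
    (hb' : b ≤ (bits DEdge p).real (closedEvent R₂ P₂))
    (h : ∀ (η : DEdge → Bool) (S T : Finset (ℤ × ℤ)), (S : Set (ℤ × ℤ)) ⊆ R₁ → P₁ S →
      ClosedIn η R₁ S → (T : Set (ℤ × ℤ)) ⊆ R₂ → P₂ T → ClosedIn η R₂ T → η ∈ closedEvent R P) :
    a * b ≤ (bits DEdge p).real (closedEvent R P) := by
  refine (mul_le_mul ha' hb' hb measureReal_nonneg).trans
    (((inc_closedEvent R₁ P₁).harris p (inc_closedEvent R₂ P₂)).trans (measureReal_mono ?_))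
  rintro η ⟨⟨S, hS, hS', hS''⟩, ⟨T, hT, hT', hT''⟩⟩
  exact h η S T hS hS' hS'' hT hT' hT''

/-- The trace on the horizontal half-axis is `[0, m)`. -/
def TraceX (m : ℤ) (S : Finset (ℤ × ℤ)) : Prop := ∀ x, 0 ≤ x → ((x, 0) ∈ S ↔ x < m)

/-- The trace on the vertical half-axis is `[0, m)`. -/
def TraceY (m : ℤ) (S : Finset (ℤ × ℤ)) : Prop := ∀ y, 0 ≤ y → ((0, y) ∈ S ↔ y < m)

/-- `S` contains `[0, n)²`. -/
def CornerBox (n : ℤ) (S : Finset (ℤ × ℤ)) : Prop :=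
  ∀ x y, 0 ≤ x → 0 ≤ y → x < n → y < n → (x, y) ∈ S

lemma TraceX.union {m m' : ℤ} {S T : Finset (ℤ × ℤ)} (hS : TraceX m S) (hT : TraceX m' T) :
    TraceX (max m m') (S ∪ T) := fun x hx => by
  rw [Finset.mem_union, hS x hx, hT x hx, lt_max_iff]

lemma TraceY.union {m m' : ℤ} {S T : Finset (ℤ × ℤ)} (hS : TraceY m S) (hT : TraceY m' T) :
    TraceY (max m m') (S ∪ T) := fun x hx => by
  rw [Finset.mem_union, hS x hx, hT x hx, lt_max_iff]

lemma TraceX.inter {m m' : ℤ} {S T : Finset (ℤ × ℤ)} (hS : TraceX m S) (hT : TraceX m' T) :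
    TraceX (min m m') (S ∩ T) := fun x hx => by
  rw [Finset.mem_inter, hS x hx, hT x hx, lt_min_iff]

lemma TraceY.inter {m m' : ℤ} {S T : Finset (ℤ × ℤ)} (hS : TraceY m S) (hT : TraceY m' T) :
    TraceY (min m m') (S ∩ T) := fun x hx => by
  rw [Finset.mem_inter, hS x hx, hT x hx, lt_min_iff]

/-- The reflection of `upperQuad k` across the diagonal. -/
def rightQuad (k : ℤ) : Set (ℤ × ℤ) := {v | k ≤ v.1 ∧ 0 ≤ v.2}

/-- The reflection of `WallAt k N` across the diagonal. -/
def SideWallAt (k N : ℤ) (S : Finset (ℤ × ℤ)) : Prop :=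
  (∀ y, 0 ≤ y → ((k, y) ∈ S ↔ y < N)) ∧ ∃ m, ∀ x, k ≤ x → ((x, 0) ∈ S ↔ x < m)

/-- Two walls and a box together form a closed set around the corner. -/
lemma closed_of_walls {η : DEdge → Bool} {n : ℤ} (hn : 1 ≤ n) {S T : Finset (ℤ × ℤ)}
    (hSR : (S : Set (ℤ × ℤ)) ⊆ upperQuad (n - 1)) (hS : WallAt (n - 1) n S)
    (hSc : ClosedIn η (upperQuad (n - 1)) S) (hTR : (T : Set (ℤ × ℤ)) ⊆ rightQuad (n - 1))
    (hT : SideWallAt (n - 1) n T) (hTc : ClosedIn η (rightQuad (n - 1)) T) :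
    η ∈ closedEvent NEquad fun S => CornerBox n S ∧ (∃ m, TraceX m S) ∧ ∃ m, TraceY m S := by
  classical
  obtain ⟨hS1, m, hS2⟩ := hS
  obtain ⟨hT1, m', hT2⟩ := hT
  have hSm : ∀ x y, (x, y) ∈ S → 0 ≤ x ∧ n - 1 ≤ y := fun x y h => hSR h
  have hTm : ∀ x y, (x, y) ∈ T → n - 1 ≤ x ∧ 0 ≤ y := fun x y h => hTR h
  have hmm := (hS2 (n - 1) le_rfl).1 ((hS1 0 le_rfl).2 (by omega))
  have hmm' := (hT2 (n - 1) le_rfl).1 ((hT1 0 le_rfl).2 (by omega))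
  let U : Finset (ℤ × ℤ) := S ∪ T ∪ (Finset.Ico 0 n ×ˢ Finset.Ico 0 n)
  have hU : ∀ x y, (x, y) ∈ U ↔ (x, y) ∈ S ∨ (x, y) ∈ T ∨ (0 ≤ x ∧ x < n) ∧ 0 ≤ y ∧ y < n := by
    intro x y
    simp [U]
  refine ⟨U, ?_, ⟨?_, ⟨m', ?_⟩, ⟨m, ?_⟩⟩, ?_⟩
  · rintro ⟨x, y⟩ h
    rw [mem_NEquad]
    rcases (hU x y).1 h with h | h | h
    · have := hSm x y h; simp only; omega
    · have := hTm x y h; simp only; omega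
    · exact ⟨h.1.1, h.2.1⟩
  · intro x y hx hy hx' hy'
    exact (hU x y).2 (Or.inr (Or.inr ⟨⟨hx, hx'⟩, hy, hy'⟩))
  · intro x hx
    rw [hU]
    have := hSm x 0
    have := hTm x 0
    have := hT2 x
    by_cases h : n = 1
    · subst h; have := hS1 x hx; grind
    · grind
  · intro y hy
    rw [hU]
    have := hSm 0 y
    have := hTm 0 y
    have := hS2 y
    by_cases h : n = 1
    · subst h; have := hT1 y hy; grind
    · grind
  · have key : ∀ d x y x' y', src d = (x, y) → dst d = (x', y') →
        (x' = x + 1 ∧ y' = y ∨ x' = x - 1 ∧ y' = y ∨ x' = x ∧ y' = y + 1 ∨ x' = x ∧ y' = y - 1) →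
        src d ∈ U → dst d ∈ NEquad → dst d ∉ U → η d = blockH d := by
      intro d x y x' y' hs ht hxy h1 h2 h3
      have hS' := hSc d
      have hT' := hTc d
      rw [hs, ht] at hS' hT'
      rw [hs, hU] at h1
      rw [ht, hU] at h3
      rw [ht, mem_NEquad] at h2
      simp only [upperQuad, rightQuad, Set.mem_ofPred_eq] at hS' hT' h2
      have a1 := hSm x y
      have a2 := hTm x y
      have a3 := hS1 x
      have a4 := hT1 y
      grind
    intro d
    induction d using DEdge.cases with
    | right x y => exact key _ x y (x + 1) y rfl rfl (by omega)
    | left x y => exact key _ (x + 1) y x y rfl rfl (by omega)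
    | up x y => exact key _ x y x (y + 1) rfl rfl (by omega)
    | down x y => exact key _ x (y + 1) x y rfl rfl (by omega)

section Circuits

variable {p : unitInterval}

lemma wallBound_nonneg (p : unitInterval) : 0 ≤ wallBound p :=
  mul_nonneg (by linarith [p.2.2]) ENNReal.toReal_nonneg

lemma le_measure_corner (hp : 0 < p) {n : ℕ} (hn : 1 ≤ n) :
    wallBound p * wallBound p ≤ (bits DEdge p).real
      (closedEvent NEquad fun S => CornerBox n S ∧ (∃ m, TraceX m S) ∧ ∃ m, TraceY m S) := by
  have h1 := wallBound_le p hp (k := n - 1) (N := n) (by omega) hn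
  have h2 : wallBound p ≤ (bits DEdge p).real
      (closedEvent (rightQuad (n - 1)) (SideWallAt (n - 1) n)) := by
    refine h1.trans (LatticeSymm.swap.le_measure_closedEvent p (fun v => and_comm) ?_)
    rintro S - ⟨hS1, m, hS2⟩
    refine ⟨fun y hy => ?_, m, fun x hx => ?_⟩
    · rw [LatticeSymm.mem_image]; exact hS1 y hy
    · rw [LatticeSymm.mem_image]; exact hS2 x hx
  exact mul_le_measure_closedEvent p (wallBound_nonneg p) h1 h2
    fun η S T a1 a2 a3 b1 b2 b3 => closed_of_walls (by exact_mod_cast hn) a1 a2 a3 b1 b2 b3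

/-- By continuity, a closed set with some property can be found in a large box with almost the same
probability. -/
lemma exists_bounded_closedEvent (R : Set (ℤ × ℤ)) (P : Finset (ℤ × ℤ) → Prop) {a : ℝ}
    (ha : a < (bits DEdge p).real (closedEvent R P)) (M₀ : ℕ) : ∃ M ≥ M₀, a ≤ (bits DEdge p).real
      (closedEvent R fun S => P S ∧ ∀ v ∈ S, |v.1| < (M : ℤ) ∧ |v.2| < (M : ℤ)) := by
  set s : ℕ → Set (DEdge → Bool) := fun M =>
    closedEvent R fun S => P S ∧ ∀ v ∈ S, |v.1| < (M : ℤ) ∧ |v.2| < (M : ℤ)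
  have hs : Monotone s := by
    rintro M M' h η ⟨S, hR, ⟨hP, hM⟩, hc⟩
    refine ⟨S, hR, ⟨hP, fun v hv => ?_⟩, hc⟩
    have := hM v hv
    have : (M : ℤ) ≤ M' := by exact_mod_cast h
    omega
  have hU : ⋃ M, s M = closedEvent R P := by
    ext η
    rw [Set.mem_iUnion]
    constructor
    · rintro ⟨M, S, hR, ⟨hP, hM⟩, hc⟩
      exact ⟨S, hR, hP, hc⟩
    · rintro ⟨S, hR, hP, hc⟩
      refine ⟨S.sup (fun v => v.1.natAbs + v.2.natAbs) + 1, S, hR, ⟨hP, fun v hv => ?_⟩, hc⟩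
      have := Finset.le_sup (f := fun v : ℤ × ℤ => v.1.natAbs + v.2.natAbs) hv
      rw [Int.abs_eq_natAbs, Int.abs_eq_natAbs]
      omega
  have hlim := tendsto_measureReal_iUnion (bits DEdge p) hs
  rw [hU] at hlim
  obtain ⟨M, hM, hM'⟩ := ((hlim.eventually (lt_mem_nhds ha)).and
    (Filter.eventually_ge_atTop M₀)).exists
  exact ⟨M, hM', hM.le⟩

/-- A closed set around the corner whose horizontal trace is prescribed. -/
lemma exists_le_measure_traceX (hp : 0 < p) (hc : 0 < wallBound p) {n : ℕ} (hn : 1 ≤ n) :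
    ∃ N : ℤ, wallBound p * wallBound p / 2 * wallBound p ≤ (bits DEdge p).real
      (closedEvent NEquad fun S => CornerBox n S ∧ TraceX N S ∧ ∃ m, TraceY m S) := by
  have hlt : wallBound p * wallBound p / 2 < wallBound p * wallBound p :=
    half_lt_self (mul_pos hc hc)
  obtain ⟨N, hN, h⟩ := exists_bounded_closedEvent NEquad _
    (hlt.trans_le (le_measure_corner hp hn)) 1
  refine ⟨N, mul_le_measure_closedEvent p hc.le h (wallBound_le p hp (k := 0) le_rfl hN) ?_⟩
  rintro η S T hSR ⟨⟨hB, ⟨m, hm⟩, ⟨m', hm'⟩⟩, hSN⟩ hSc hTR ⟨hT, ⟨l, hl⟩⟩ hTc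
  refine ⟨S ∪ T, ?_, ⟨?_, ?_, _, hm'.union hl⟩, hSc.union hTc⟩
  · rw [Finset.coe_union]
    exact Set.union_subset hSR hTR
  · exact fun x y a b c d => Finset.mem_union_left _ (hB x y a b c d)
  · intro x hx
    rw [Finset.mem_union]
    refine ⟨?_, fun h => Or.inr ((hT x hx).2 h)⟩
    rintro (h | h)
    · exact (abs_lt.1 (hSN _ h).1).2
    · exact (hT x hx).1 h

lemma TraceX.swap {m : ℤ} {S : Finset (ℤ × ℤ)} (h : TraceX m S) :
    TraceY m (S.image LatticeSymm.swap.onVertex) := fun x hx => by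
  rw [LatticeSymm.mem_image]; exact h x hx

lemma TraceY.swap {m : ℤ} {S : Finset (ℤ × ℤ)} (h : TraceY m S) :
    TraceX m (S.image LatticeSymm.swap.onVertex) := fun x hx => by
  rw [LatticeSymm.mem_image]; exact h x hx

lemma CornerBox.swap {n : ℤ} {S : Finset (ℤ × ℤ)} (h : CornerBox n S) :
    CornerBox n (S.image LatticeSymm.swap.onVertex) := fun x y a b c d => by
  rw [LatticeSymm.mem_image]; exact h y x b a d c

/-- A closed set around the corner with equal prescribed traces on the two axes. -/
lemma exists_le_measure_traceX_traceY {n : ℕ} {N : ℤ} {a : ℝ} (ha : 0 ≤ a)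
    (h : a ≤ (bits DEdge p).real
      (closedEvent NEquad fun S => CornerBox n S ∧ TraceX N S ∧ ∃ m, TraceY m S)) :
    a / 2 * (a / 2) ≤ (bits DEdge p).real
      (closedEvent NEquad fun S => CornerBox n S ∧ TraceX N S ∧ TraceY N S) := by
  have hU : closedEvent NEquad (fun S => CornerBox n S ∧ TraceX N S ∧ ∃ m, TraceY m S) ⊆
      closedEvent NEquad (fun S => CornerBox n S ∧ TraceX N S ∧ ∃ m ≤ N, TraceY m S) ∪
      closedEvent NEquad (fun S => CornerBox n S ∧ TraceX N S ∧ ∃ m ≥ N, TraceY m S) := by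
    rintro η ⟨S, hR, ⟨hB, hX, m, hY⟩, hc⟩
    rcases le_total m N with hm | hm
    · exact Or.inl ⟨S, hR, ⟨hB, hX, m, hm, hY⟩, hc⟩
    · exact Or.inr ⟨S, hR, ⟨hB, hX, m, hm, hY⟩, hc⟩
  have hsum := h.trans ((measureReal_mono hU).trans (measureReal_union_le _ _))
  rcases (by by_contra! hcon; linarith [hcon.1, hcon.2] :
    a / 2 ≤ (bits DEdge p).real
      (closedEvent NEquad fun S => CornerBox n S ∧ TraceX N S ∧ ∃ m ≤ N, TraceY m S) ∨
    a / 2 ≤ (bits DEdge p).real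
      (closedEvent NEquad fun S => CornerBox n S ∧ TraceX N S ∧ ∃ m ≥ N, TraceY m S)) with h1 | h1
  · have h2 : a / 2 ≤ (bits DEdge p).real
        (closedEvent NEquad fun S => CornerBox n S ∧ TraceY N S ∧ ∃ m ≤ N, TraceX m S) := by
      refine h1.trans (LatticeSymm.swap.le_measure_closedEvent p (fun v => and_comm) ?_)
      rintro S - ⟨hB, hX, m, hm, hY⟩
      exact ⟨hB.swap, hX.swap, m, hm, hY.swap⟩
    refine mul_le_measure_closedEvent p (by linarith) h1 h2 ?_
    rintro η S T hSR ⟨hB, hX, m, hm, hY⟩ hSc hTR ⟨hB', hY', m', hm', hX'⟩ hTc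
    refine ⟨S ∪ T, ?_, ⟨?_, ?_, ?_⟩, hSc.union hTc⟩
    · rw [Finset.coe_union]
      exact Set.union_subset hSR hTR
    · exact fun x y a b c d => Finset.mem_union_left _ (hB x y a b c d)
    · simpa [hm'] using hX.union hX'
    · simpa [hm] using hY.union hY'
  · have h2 : a / 2 ≤ (bits DEdge p).real
        (closedEvent NEquad fun S => CornerBox n S ∧ TraceY N S ∧ ∃ m ≥ N, TraceX m S) := by
      refine h1.trans (LatticeSymm.swap.le_measure_closedEvent p (fun v => and_comm) ?_)
      rintro S - ⟨hB, hX, m, hm, hY⟩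
      exact ⟨hB.swap, hX.swap, m, hm, hY.swap⟩
    refine mul_le_measure_closedEvent p (by linarith) h1 h2 ?_
    rintro η S T hSR ⟨hB, hX, m, hm, hY⟩ hSc hTR ⟨hB', hY', m', hm', hX'⟩ hTc
    refine ⟨S ∩ T, ?_, ⟨?_, ?_, ?_⟩, hSc.inter hTc⟩
    · rw [Finset.coe_inter]
      exact Set.inter_subset_left.trans hSR
    · exact fun x y a b c d => Finset.mem_inter.2 ⟨hB x y a b c d, hB' x y a b c d⟩
    · simpa [min_eq_left hm'] using hX.inter hX'
    · simpa [min_eq_right hm] using hY.inter hY'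

lemma ClosedIn.glue {η : DEdge → Bool} {R₁ R₂ R : Set (ℤ × ℤ)} {S₁ S₂ : Finset (ℤ × ℤ)}
    (h₁ : ClosedIn η R₁ S₁) (h₂ : ClosedIn η R₂ S₂)
    (hcov : ∀ d, src d ∈ R → dst d ∈ R → (src d ∈ R₁ ∧ dst d ∈ R₁) ∨ (src d ∈ R₂ ∧ dst d ∈ R₂))
    (hS₁ : (S₁ : Set (ℤ × ℤ)) ⊆ R₁) (hS₂ : (S₂ : Set (ℤ × ℤ)) ⊆ R₂) (hR₁ : R₁ ⊆ R) (hR₂ : R₂ ⊆ R)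
    (hagree : ∀ v ∈ R₁, v ∈ R₂ → (v ∈ S₁ ↔ v ∈ S₂)) : ClosedIn η R (S₁ ∪ S₂) := by
  intro d h1 h2 h3
  rw [Finset.mem_union] at h1
  rw [Finset.mem_union, not_or] at h3
  have hsR : src d ∈ R := h1.elim (fun h => hR₁ (hS₁ h)) (fun h => hR₂ (hS₂ h))
  rcases hcov d hsR h2 with ⟨hs, ht⟩ | ⟨hs, ht⟩
  · exact h₁ d (h1.elim id fun h => (hagree _ hs (hS₂ h)).2 h) ht h3.1
  · exact h₂ d (h1.elim (fun h => (hagree _ (hS₁ h) hs).1 h) id) ht h3.2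

lemma le_measure_half_plane {n : ℕ} {N : ℤ} {a : ℝ} (ha : 0 ≤ a)
    (h : a ≤ (bits DEdge p).real
      (closedEvent NEquad fun S => CornerBox n S ∧ TraceX N S ∧ TraceY N S)) :
    a * a ≤ (bits DEdge p).real (closedEvent {v | 0 ≤ v.2} fun S =>
      (∀ x y : ℤ, |x| < n → 0 ≤ y → y < n → (x, y) ∈ S) ∧ ∀ x, (x, 0) ∈ S ↔ |x| < N) := by
  have h' : a ≤ (bits DEdge p).real (closedEvent {v | v.1 ≤ 0 ∧ 0 ≤ v.2} fun S =>
      CornerBox n (S.image LatticeSymm.negX.onVertex) ∧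
      TraceX N (S.image LatticeSymm.negX.onVertex) ∧ TraceY N S) := by
    refine h.trans (LatticeSymm.negX.le_measure_closedEvent p (fun v => ?_) ?_)
    · simp [LatticeSymm.negX, mem_NEquad]
    · rintro S - ⟨hB, hX, hY⟩
      have : (S.image LatticeSymm.negX.onVertex).image LatticeSymm.negX.onVertex = S := by
        ext v
        rw [LatticeSymm.mem_image, LatticeSymm.mem_image, LatticeSymm.negX.onVertex_invol]
      rw [this]
      refine ⟨hB, hX, fun y hy => ?_⟩
      rw [LatticeSymm.mem_image, ← hY y hy]
      simp [LatticeSymm.negX]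
  refine mul_le_measure_closedEvent p ha h h' ?_
  rintro η S T hSR ⟨hB, hX, hY⟩ hSc hTR ⟨hB', hX', hY'⟩ hTc
  have hB'' : ∀ x y : ℤ, 0 ≤ x → 0 ≤ y → x < n → y < n → (-x, y) ∈ T := fun x y a b c d =>
    LatticeSymm.negX.mem_image.1 (hB' x y a b c d)
  have hX'' : ∀ x, 0 ≤ x → ((-x, 0) ∈ T ↔ x < N) := fun x hx => by
    rw [← hX' x hx, LatticeSymm.mem_image]; rfl
  have hSm : ∀ x y, (x, y) ∈ S → 0 ≤ x ∧ 0 ≤ y := fun x y h => hSR h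
  have hTm : ∀ x y, (x, y) ∈ T → x ≤ 0 ∧ 0 ≤ y := fun x y h => hTR h
  refine ⟨S ∪ T, ?_, ⟨fun x y hx hy hy' => ?_, fun x => ?_⟩,
    hSc.glue hTc (fun d => ?_) hSR hTR (fun v hv => hv.2) (fun v hv => hv.2) ?_⟩
  · rw [Finset.coe_union]
    exact Set.union_subset (fun v hv => (hSR hv).2) (fun v hv => (hTR hv).2)
  · rw [abs_lt] at hx
    rw [Finset.mem_union]
    rcases le_total 0 x with h0 | h0
    · exact Or.inl (hB x y h0 hy hx.2 hy')
    · right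
      have := hB'' (-x) y (by omega) hy (by omega) hy'
      rwa [neg_neg] at this
  · rw [Finset.mem_union]
    have a1 := hX x
    have a2 := hX'' (-x)
    rw [neg_neg] at a2
    have := hSm x 0
    have := hTm x 0
    rcases le_total 0 x with h0 | h0
    · rw [abs_of_nonneg h0]; grind
    · rw [abs_of_nonpos h0]; grind
  · simp only [mem_NEquad, Set.mem_ofPred_eq]
    induction d using DEdge.cases <;> simp <;> omega
  · rintro ⟨x, y⟩ hv ⟨hv1, -⟩
    have hx : x = 0 := le_antisymm hv1 hv.1
    subst hx
    rw [hY y hv.2, hY' y hv.2]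

lemma le_measure_plane {n : ℕ} {N : ℤ} {a : ℝ} (ha : 0 ≤ a)
    (h : a ≤ (bits DEdge p).real (closedEvent {v | 0 ≤ v.2} fun S =>
      (∀ x y : ℤ, |x| < n → 0 ≤ y → y < n → (x, y) ∈ S) ∧ ∀ x, (x, 0) ∈ S ↔ |x| < N)) :
    a * a ≤ (bits DEdge p).real (closedEvent Set.univ fun S =>
      ∀ v : ℤ × ℤ, |v.1| < n → |v.2| < n → v ∈ S) := by
  have h' : a ≤ (bits DEdge p).real (closedEvent {v | v.2 ≤ 0} fun S =>
      (∀ x y : ℤ, |x| < n → 0 ≤ y → y < n → (x, -y) ∈ S) ∧ ∀ x, (x, 0) ∈ S ↔ |x| < N) := by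
    refine h.trans (LatticeSymm.negY.le_measure_closedEvent p (fun v => ?_) ?_)
    · simp [LatticeSymm.negY]
    · rintro S - ⟨hB, hX⟩
      refine ⟨fun x y hx hy hy' => ?_, fun x => ?_⟩
      · rw [LatticeSymm.mem_image]
        simpa [LatticeSymm.negY] using hB x y hx hy hy'
      · rw [LatticeSymm.mem_image, ← hX x]
        simp [LatticeSymm.negY]
  refine mul_le_measure_closedEvent p ha h h' ?_
  rintro η S T hSR ⟨hB, hX⟩ hSc hTR ⟨hB', hX'⟩ hTc
  refine ⟨S ∪ T, Set.subset_univ _, fun ⟨x, y⟩ hx hy => ?_,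
    hSc.glue hTc (fun d => ?_) hSR hTR (Set.subset_univ _) (Set.subset_univ _) ?_⟩
  · rw [Finset.mem_union]
    rw [abs_lt] at hy
    rcases le_total 0 y with h0 | h0
    · exact Or.inl (hB x y hx h0 hy.2)
    · right
      have := hB' x (-y) hx (by omega) (by simp only at hy; omega)
      rwa [neg_neg] at this
  · simp only [Set.mem_ofPred_eq]
    induction d using DEdge.cases <;> simp <;> omega
  · rintro ⟨x, y⟩ hv hv'
    have hy : y = 0 := le_antisymm hv' hv
    subst hy
    rw [hX x, hX' x]

/-- Every box is contained in a closed set with probability bounded away from zero. -/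
lemma exists_le_measure_closed_plane (hp : 0 < p) (hc : 0 < wallBound p) :
    ∃ c : ℝ, 0 < c ∧ ∀ n : ℕ, c ≤ (bits DEdge p).real
      (closedEvent Set.univ fun S => ∀ v : ℤ × ℤ, |v.1| < n → |v.2| < n → v ∈ S) := by
  set a := wallBound p * wallBound p / 2 * wallBound p with ha
  have ha0 : 0 < a := by positivity
  set b := a / 2 * (a / 2) with hb
  have hb0 : 0 < b := by positivity
  refine ⟨b * b * (b * b), by positivity, fun n => ?_⟩
  obtain ⟨N, hN⟩ := exists_le_measure_traceX hp hc (n := n + 1) (by omega)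
  refine (le_measure_plane (by positivity) (le_measure_half_plane hb0.le
    (exists_le_measure_traceX_traceY ha0.le hN))).trans (measureReal_mono ?_)
  rintro η ⟨S, hR, hS, hc⟩
  refine ⟨S, hR, fun v h1 h2 => hS v ?_ ?_, hc⟩ <;> push_cast <;> omega

end Circuits

/-! ### Closed sets surround the origin almost surely -/

lemma dependsOnCoords_closedEvent {R : Set (ℤ × ℤ)} {P : Finset (ℤ × ℤ) → Prop} {K : Set DEdge}
    (h : ∀ S, P S → ∀ d, src d ∈ S → dst d ∈ R → dst d ∉ S → d ∈ K) :
    DependsOnCoords (closedEvent R P) K := by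
  have key : ∀ η η' : DEdge → Bool, (∀ d ∈ K, η d = η' d) → η ∈ closedEvent R P →
      η' ∈ closedEvent R P := by
    rintro η η' hη ⟨S, hR, hP, hc⟩
    exact ⟨S, hR, hP, fun d h1 h2 h3 => by rw [← hη d (h S hP d h1 h2 h3), hc d h1 h2 h3]⟩
  exact fun η η' hη => ⟨key η η' hη, key η' η fun d hd => (hη d hd).symm⟩

lemma DependsOnCoords.compl {I : Type*} {A : Set (I → Bool)} {K : Set I}
    (h : DependsOnCoords A K) : DependsOnCoords Aᶜ K :=
  fun ω ω' hω => not_congr (h ω ω' hω)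

/-- The open box of radius `n` is contained in `S`. -/
def ContainsBox (n : ℕ) (S : Finset (ℤ × ℤ)) : Prop :=
  ∀ v : ℤ × ℤ, |v.1| < n → |v.2| < n → v ∈ S

lemma measure_compl_closed_plane_le {p : unitInterval} {c : ℝ} (hc : 0 < c)
    (h : ∀ n : ℕ, c ≤ (bits DEdge p).real (closedEvent Set.univ (ContainsBox n))) (j n : ℕ) :
    (bits DEdge p).real (closedEvent Set.univ (ContainsBox n))ᶜ ≤ (1 - c / 2) ^ j := by
  induction j generalizing n with
  | zero => simp
  | succ j ih =>
    obtain ⟨M, hM, hcM⟩ := exists_bounded_closedEvent Set.univ (ContainsBox n)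
      ((half_lt_self hc).trans_le (h n)) n
    set A := closedEvent Set.univ fun S =>
      ContainsBox n S ∧ ∀ v ∈ S, |v.1| < (M : ℤ) ∧ |v.2| < (M : ℤ)
    have hmA : MeasurableSet A := (inc_closedEvent _ _).measurableSet
    have hmB : MeasurableSet (closedEvent Set.univ (ContainsBox (M + 1))) :=
      (inc_closedEvent _ _).measurableSet
    have hsub : (closedEvent Set.univ (ContainsBox n))ᶜ ⊆
        Aᶜ ∩ (closedEvent Set.univ (ContainsBox (M + 1)))ᶜ := by
      rw [← Set.compl_union, Set.compl_subset_compl]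
      rintro η (⟨S, hR, hS, hcl⟩ | ⟨S, hR, hS, hcl⟩)
      · exact ⟨S, hR, hS.1, hcl⟩
      · refine ⟨S, hR, fun v h1 h2 => hS v ?_ ?_, hcl⟩ <;> push_cast <;> omega
    have hdA : DependsOnCoords A {d | |(src d).1| < (M : ℤ) ∧ |(src d).2| < (M : ℤ)} :=
      dependsOnCoords_closedEvent fun S hS d h1 _ _ => hS.2 _ h1
    have hdB : DependsOnCoords (closedEvent Set.univ (ContainsBox (M + 1)))
        {d | ¬ (|(src d).1| < (M : ℤ) ∧ |(src d).2| < (M : ℤ))} := by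
      refine dependsOnCoords_closedEvent fun S hS d _ _ h3 hd => h3 (hS _ ?_ ?_)
      all_goals
        revert hd
        simp only [abs_lt]
        induction d using DEdge.cases <;> simp <;> omega
    have hmul : (bits DEdge p).real (Aᶜ ∩ (closedEvent Set.univ (ContainsBox (M + 1)))ᶜ)
        = (bits DEdge p).real Aᶜ
          * (bits DEdge p).real (closedEvent Set.univ (ContainsBox (M + 1)))ᶜ := by
      rw [measureReal_def, hdA.compl.measure_inter p hmA.compl hmB.compl hdB.compl,
        ENNReal.toReal_mul, measureReal_def, measureReal_def]
      exact Set.disjoint_left.2 fun d h1 h2 => h2 h1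
    have hA1 : (bits DEdge p).real Aᶜ ≤ 1 - c / 2 := by
      rw [probReal_compl_eq_one_sub hmA]
      linarith
    calc _ ≤ _ := measureReal_mono hsub
      _ = _ := hmul
      _ ≤ (1 - c / 2) * (1 - c / 2) ^ j :=
        mul_le_mul hA1 (ih _) measureReal_nonneg (measureReal_nonneg.trans hA1)
      _ = _ := (pow_succ' _ _).symm

lemma measure_closed_plane_eq_one {p : unitInterval} (hp : 0 < p) (hc : 0 < wallBound p) :
    (bits DEdge p).real (closedEvent Set.univ (ContainsBox 1)) = 1 := by
  obtain ⟨c, hc0, h⟩ := exists_le_measure_closed_plane hp hc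
  have hm : MeasurableSet (closedEvent Set.univ (ContainsBox 1)) :=
    (inc_closedEvent _ _).measurableSet
  have hc1 : c ≤ 1 := (h 0).trans measureReal_le_one
  have hlim := tendsto_pow_atTop_nhds_zero_of_lt_one (r := 1 - c / 2) (by linarith) (by linarith)
  have h0 := ge_of_tendsto' hlim fun j => measure_compl_closed_plane_le hc0 h j 1
  rw [probReal_compl_eq_one_sub hm] at h0
  exact le_antisymm measureReal_le_one (by linarith)

lemma reachEvent_subset_compl_closedEvent (M : ℕ) :
    reachEvent openH Set.univ (0, 0) {v | ¬ (|v.1| < (M : ℤ) ∧ |v.2| < (M : ℤ))} ⊆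
      (closedEvent Set.univ fun S =>
        ContainsBox 1 S ∧ ∀ v ∈ S, |v.1| < (M : ℤ) ∧ |v.2| < (M : ℤ))ᶜ := by
  rintro η ⟨z, hz, hr⟩ ⟨S, -, ⟨hS, hSM⟩, hcl⟩
  refine hz (hSM z ?_)
  clear hz
  induction hr with
  | refl => exact hS _ (by simp) (by simp)
  | tail _ h ih =>
    obtain ⟨d, ⟨-, hd⟩, rfl, rfl⟩ := h
    by_contra hn
    have := hcl d ih trivial hn
    rw [hd, blockH] at this
    simp at this

lemma reachEvent_of_percolates {ω : Config} (hω : percolates (hStep ω) Set.univ) (M : ℕ) :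
    (fun d : DEdge => ω d.1) ∈
      reachEvent openH Set.univ (0, 0) {v | ¬ (|v.1| < (M : ℤ) ∧ |v.2| < (M : ℤ))} := by
  obtain ⟨γ, h0, hinj, hstep, -⟩ := hω
  have key : ∀ n, Relation.ReflTransGen (fun u v => ∃ d ∈ {d ∈ Set.univ | ω d.1 = openH d},
      src d = u ∧ dst d = v) (0, 0) (γ n) := by
    intro n
    induction n with
    | zero => rw [h0]
    | succ n ih =>
      obtain ⟨d, hd, hs, ht⟩ := hStep_iff.1 (hstep n)
      exact ih.tail ⟨d, ⟨trivial, hd⟩, hs, ht⟩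
  by_contra hno
  have hfin : (Set.range γ).Finite := by
    refine (Set.finite_Icc (-(M : ℤ), -(M : ℤ)) ((M : ℤ), (M : ℤ))).subset ?_
    rintro _ ⟨n, rfl⟩
    have : |(γ n).1| < (M : ℤ) ∧ |(γ n).2| < (M : ℤ) := by
      by_contra h
      exact hno ⟨γ n, h, key n⟩
    rw [abs_lt, abs_lt] at this
    exact ⟨⟨this.1.1.le, this.2.1.le⟩, ⟨this.1.2.le, this.2.2.le⟩⟩
  exact Set.infinite_range_of_injective hinj hfin

lemma thetaH_eq_zero_of_wallBound {p : unitInterval} (hp : 0 < p) (hc : 0 < wallBound p) :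
    thetaH p = 0 := by
  have hle : ∀ a < 1, (thetaH p).toReal ≤ 1 - a := by
    intro a ha
    rw [← measure_closed_plane_eq_one hp hc] at ha
    obtain ⟨M, -, hM⟩ := exists_bounded_closedEvent _ _ ha 0
    have h1 : thetaH p ≤ bits DEdge p (closedEvent Set.univ fun S =>
        ContainsBox 1 S ∧ ∀ v ∈ S, |v.1| < (M : ℤ) ∧ |v.2| < (M : ℤ))ᶜ := by
      rw [thetaH, mu_eq_bits]
      exact (measure_mono fun ω hω => reachEvent_of_percolates hω M).trans
        ((measure_reachEvent_orientation_le p _ _ _ _).trans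
          (measure_mono (reachEvent_subset_compl_closedEvent M)))
    refine (ENNReal.toReal_mono (measure_ne_top _ _) h1).trans ?_
    rw [← measureReal_def, probReal_compl_eq_one_sub (inc_closedEvent _ _).measurableSet]
    linarith
  have h0 : (thetaH p).toReal ≤ 0 := by
    by_contra! h
    linarith [hle (1 - (thetaH p).toReal / 2) (by linarith)]
  have hfin : thetaH p ≠ ∞ := by
    rw [thetaH, mu_eq_bits]
    exact measure_ne_top _ _
  exact ((ENNReal.toReal_eq_zero_iff _).1 (le_antisymm h0 ENNReal.toReal_nonneg)).resolve_right hfin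

lemma thetaH_zero : thetaH 0 = 0 := by
  have h : mu 0 = bits Edge 0 := mu_eq_bits 0
  rw [thetaH, h]
  refine measure_mono_null (t := ⋃ e : Edge, {ω | ω e ∈ ({true} : Set Bool)}) ?_
    (measure_iUnion_null fun e => by rw [bits_coord, bern_true]; simp)
  rintro ω ⟨γ, h0, hinj, hstep, -⟩
  obtain ⟨e, -, he⟩ := hstep 0
  refine Set.mem_iUnion.2 ⟨e, ?_⟩
  have hne : γ 1 ≠ (0, 0) := fun h => by simpa using hinj (h.trans h0.symm)
  rw [Set.mem_ofPred_eq, he, h0, Set.mem_singleton_iff, decide_eq_true_iff]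
  have : (γ (0 + 1)).1 ≠ 0 ∨ (γ (0 + 1)).2 ≠ 0 := by
    by_contra! h
    exact hne (Prod.ext h.1 h.2)
  simp only [normSq]
  rcases this with h | h <;> positivity

lemma percolates_hStep_of_gStep {ω : Config} (h : percolates (gStep ω) NEquad) :
    percolates (hStep ω) Set.univ := by
  obtain ⟨γ, h0, hinj, hstep, hmem⟩ := h
  refine ⟨γ, h0, hinj, fun n => ?_, fun n => trivial⟩
  obtain ⟨d, hd, hs, ht⟩ := gStep_iff.1 (hstep n)
  refine hStep_iff.2 ⟨d, ?_, hs, ht⟩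
  have := blockH_of_NEquad (d := d) (hs ▸ hmem n) (ht ▸ hmem (n + 1))
  rw [hd, openG, ← Bool.not_not (openH d)]
  exact (Bool.not_not d.2).symm.trans (congrArg _ this.symm)

/-- If `θ_NE(p) > 0` for every `p > 1/2`, then the H-model has critical
probability `1/2`: `θ_H(p) = 0` for every `p < 1/2` and `θ_H(p) > 0` for every
`p > 1/2`. -/
theorem thetaH_critical_of_NE_conjecture
    (hNE : ∀ p : ℝ, 1 / 2 < p → p ≤ 1 → 0 < thetaNE p) :
    (∀ p : ℝ, 0 ≤ p → p < 1 / 2 → thetaH p = 0) ∧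
    (∀ p : ℝ, 1 / 2 < p → p ≤ 1 → 0 < thetaH p) := by
  refine ⟨fun p h0 h1 => ?_, fun p h0 h1 =>
    (hNE p h0 h1).trans_le (measure_mono fun ω => percolates_hStep_of_gStep)⟩
  rcases h0.eq_or_lt with rfl | h0
  · exact thetaH_zero
  · have hfin : thetaNE (1 - p) ≠ ∞ := by
      have := mu_eq_bits ⟨1 - p, by linarith, by linarith⟩
      rw [thetaNE, this]
      exact measure_ne_top _ _
    have hpos := ENNReal.toReal_pos (hNE (1 - p) (by linarith) (by linarith)).ne' hfin
    exact thetaH_eq_zero_of_wallBound (p := ⟨p, h0.le, by linarith⟩) h0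
      (mul_pos (by linarith) hpos)

end RandomOrientation
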